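/- arXiv:math/0409205 — 2 statements merged into one kernel-verified Lean document; each statement's English description precedes it below -/
import Mathlib

section
/- (Paris) The desingularization map is injective: there is a well-defined monoid homomorphism ψ from the singular braid monoid SB_n to the multiplicative monoid of the integral group ring ℤB_n (the monoid algebra of B_n over ℤ) determined by ψ(σ_i) = σ_i, ψ(σ̄_i) = σ_i⁻¹, and ψ(τ_i) = σ_i − σ_i⁻¹, and ψ is injective. -/
/-- The set of relators for Artin's classical presentation of the braid group `Bₙ`:
generators `σ₁, …, σ_{n-1}` (indexed by `Fin (n-1)`), with relations
`σᵢ σₖ = σₖ σᵢ` when `|i - k| ≥ 2` and `σᵢ σ_{i+1} σᵢ = σ_{i+1} σᵢ σ_{i+1}`. -/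
def braidRels (n : ℕ) : Set (FreeGroup (Fin (n - 1))) :=
  {w | (∃ i k : Fin (n - 1), (i : ℕ) + 2 ≤ (k : ℕ) ∧
          w = FreeGroup.of i * FreeGroup.of k * (FreeGroup.of k * FreeGroup.of i)⁻¹) ∨
       (∃ i k : Fin (n - 1), (i : ℕ) + 1 = (k : ℕ) ∧
          w = FreeGroup.of i * FreeGroup.of k * FreeGroup.of i *
              (FreeGroup.of k * FreeGroup.of i * FreeGroup.of k)⁻¹)}

/-- The braid group `Bₙ`, given by Artin's classical presentation. -/
abbrev BraidGroup (n : ℕ) : Type := PresentedGroup (braidRels n)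

/-- Generators of the singular braid monoid `SBₙ`: the positive elementary braids `σᵢ`,
their formal inverses `σ̄ᵢ`, and the elementary singular braids `τᵢ`, for `1 ≤ i ≤ n-1`. -/
inductive SGen (n : ℕ) : Type
  | pos : Fin (n - 1) → SGen n
  | neg : Fin (n - 1) → SGen n
  | sing : Fin (n - 1) → SGen n

/-- The letter `g` viewed as a one-letter word in the free monoid. -/
def sw {n : ℕ} (g : SGen n) : FreeMonoid (SGen n) := FreeMonoid.of g

/-- The defining relations of the singular braid monoid `SBₙ`:
`σᵢ σ̄ᵢ = σ̄ᵢ σᵢ = 1`; `σᵢ τᵢ = τᵢ σᵢ`; for `|i - j| ≥ 2`, `σᵢ σⱼ = σⱼ σᵢ`,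
`σᵢ τⱼ = τⱼ σᵢ` and `τᵢ τⱼ = τⱼ τᵢ`; and for `|i - j| = 1`,
`σᵢ σⱼ σᵢ = σⱼ σᵢ σⱼ` and `σᵢ σⱼ τᵢ = τⱼ σᵢ σⱼ`. -/
inductive SBRel (n : ℕ) : FreeMonoid (SGen n) → FreeMonoid (SGen n) → Prop
  | posNeg (i : Fin (n - 1)) : SBRel n (sw (.pos i) * sw (.neg i)) 1
  | negPos (i : Fin (n - 1)) : SBRel n (sw (.neg i) * sw (.pos i)) 1
  | posSing (i : Fin (n - 1)) :
      SBRel n (sw (.pos i) * sw (.sing i)) (sw (.sing i) * sw (.pos i))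
  | commPosPos (i j : Fin (n - 1)) (h : (i : ℕ) + 2 ≤ (j : ℕ) ∨ (j : ℕ) + 2 ≤ (i : ℕ)) :
      SBRel n (sw (.pos i) * sw (.pos j)) (sw (.pos j) * sw (.pos i))
  | commPosSing (i j : Fin (n - 1)) (h : (i : ℕ) + 2 ≤ (j : ℕ) ∨ (j : ℕ) + 2 ≤ (i : ℕ)) :
      SBRel n (sw (.pos i) * sw (.sing j)) (sw (.sing j) * sw (.pos i))
  | commSingSing (i j : Fin (n - 1)) (h : (i : ℕ) + 2 ≤ (j : ℕ) ∨ (j : ℕ) + 2 ≤ (i : ℕ)) :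
      SBRel n (sw (.sing i) * sw (.sing j)) (sw (.sing j) * sw (.sing i))
  | braidPos (i j : Fin (n - 1)) (h : (i : ℕ) + 1 = (j : ℕ) ∨ (j : ℕ) + 1 = (i : ℕ)) :
      SBRel n (sw (.pos i) * sw (.pos j) * sw (.pos i))
        (sw (.pos j) * sw (.pos i) * sw (.pos j))
  | braidSing (i j : Fin (n - 1)) (h : (i : ℕ) + 1 = (j : ℕ) ∨ (j : ℕ) + 1 = (i : ℕ)) :
      SBRel n (sw (.pos i) * sw (.pos j) * sw (.sing i))
        (sw (.sing j) * sw (.pos i) * sw (.pos j))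

/-- The singular braid monoid `SBₙ`. -/
abbrev SBMonoid (n : ℕ) : Type := (conGen (SBRel n)).Quotient

/-- The class of a generator in the singular braid monoid `SBₙ`. -/
def sGen (n : ℕ) (g : SGen n) : SBMonoid n := (conGen (SBRel n)).mk' (sw g)

namespace FreeGroup

variable {α : Type*} [DecidableEq α]

/-- The reduced word of `f` starts with the letter `s` or its inverse. -/
def HeadIs (s : α) (f : FreeGroup α) : Prop := ∃ b l, f.toWord = (s, b) :: l

theorem headIs_unique {s t : α} {f : FreeGroup α} (hs : HeadIs s f) (ht : HeadIs t f) :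
    s = t := by
  obtain ⟨b, l, h⟩ := hs
  obtain ⟨b', l', h'⟩ := ht
  rw [h] at h'
  simp_all

theorem not_headIs_one (s : α) : ¬ HeadIs s (1 : FreeGroup α) := by
  rintro ⟨b, l, h⟩
  simp at h

theorem exists_headIs {f : FreeGroup α} (hf : f ≠ 1) : ∃ s, HeadIs s f := by
  rcases h : f.toWord with _ | ⟨⟨s, b⟩, l⟩
  · exact absurd (toWord_eq_nil_iff.1 h) hf
  · exact ⟨s, b, l, h⟩

theorem headIs_inv_of_toWord_eq_append {u : FreeGroup α} {s : α} {b : Bool} {l}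
    (h : u.toWord = l ++ [(s, b)]) : HeadIs s u⁻¹ := by
  refine ⟨!b, invRev l, ?_⟩
  rw [toWord_inv, h]
  simp [invRev]

theorem toWord_mul_of_not_headIs {u v : FreeGroup α}
    (h : ∀ s, HeadIs s u⁻¹ → ¬ HeadIs s v) : (u * v).toWord = u.toWord ++ v.toWord := by
  rw [toWord_mul]
  apply IsReduced.reduce_eq
  rw [IsReduced, List.isChain_append]
  refine ⟨isReduced_toWord, isReduced_toWord, ?_⟩
  rintro ⟨s, b⟩ hx ⟨t, c⟩ hy
  intro hst
  simp only at hst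
  subst hst
  exfalso
  obtain ⟨l, hl⟩ := List.getLast?_eq_some_iff.1 hx
  obtain ⟨l', hl'⟩ := List.head?_eq_some_iff.1 hy
  exact h s (headIs_inv_of_toWord_eq_append hl) ⟨c, l', hl'⟩

theorem HeadIs.mul {u v : FreeGroup α} {t : α} (hu : HeadIs t u)
    (h : ∀ s, HeadIs s u⁻¹ → ¬ HeadIs s v) : HeadIs t (u * v) := by
  obtain ⟨b, l, hl⟩ := hu
  exact ⟨b, l ++ v.toWord, by simp [toWord_mul_of_not_headIs h, hl]⟩

theorem headIs_of_zpow (s : α) {m : ℤ} (hm : m ≠ 0) : HeadIs s (of s ^ m) := by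
  obtain ⟨k, rfl | rfl⟩ := m.eq_nat_or_neg
  · obtain ⟨k, rfl⟩ := Nat.exists_eq_succ_of_ne_zero (n := k) (by omega)
    exact ⟨true, List.replicate k (s, true), by
      rw [zpow_natCast, toWord_of_pow, List.replicate_succ]⟩
  · obtain ⟨k, rfl⟩ := Nat.exists_eq_succ_of_ne_zero (n := k) (by omega)
    exact ⟨false, List.replicate k (s, false), by
      rw [zpow_neg, zpow_natCast, toWord_inv, toWord_of_pow, ← List.replicate_succ]
      simp [invRev]⟩

theorem norm_of_zpow_pos (s : α) {m : ℤ} (hm : m ≠ 0) : 0 < norm (of s ^ m) := by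
  obtain ⟨b, l, h⟩ := headIs_of_zpow s hm
  simp [norm, h]

theorem exists_zpow_mul_not_headIs (s : α) (f : FreeGroup α) :
    ∃ (e : ℤ) (f' : FreeGroup α), f = of s ^ e * f' ∧ ¬ HeadIs s f' := by
  induction hn : f.norm using Nat.strong_induction_on generalizing f with
  | _ n ih =>
    by_cases h : HeadIs s f
    · obtain ⟨b, l, hl⟩ := h
      have hf : f = (if b then of s else (of s)⁻¹) * mk l := by
        rw [← mk_toWord (x := f), hl]
        cases b <;> simp [of, inv_mk, mul_mk, invRev]
      have hlt : (mk l).norm < n := by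
        have := norm_mk_le (L₁ := l)
        have h2 : f.norm = l.length + 1 := by simp [norm, hl]
        omega
      obtain ⟨e, f', h1, h2⟩ := ih _ hlt (mk l) rfl
      cases b
      · exact ⟨-1 + e, f', by rw [hf, h1]; simp [zpow_add, mul_assoc], h2⟩
      · exact ⟨1 + e, f', by rw [hf, h1]; simp [zpow_add, mul_assoc], h2⟩
    · exact ⟨0, f, by simp, h⟩

theorem exists_mul_zpow_not_headIs (s : α) (f : FreeGroup α) :
    ∃ (e : ℤ) (f' : FreeGroup α), f = f' * of s ^ e ∧ ¬ HeadIs s f'⁻¹ := by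
  obtain ⟨e, f', h1, h2⟩ := exists_zpow_mul_not_headIs s f⁻¹
  refine ⟨-e, f'⁻¹, ?_, by simpa using h2⟩
  rw [← inv_inv f, h1]
  simp

theorem not_headIs_of_mul_zpow {s t : α} {f : FreeGroup α} {e : ℤ}
    (hf : ¬ HeadIs s f⁻¹) (h : ¬ HeadIs t (f * of s ^ e)) : ¬ HeadIs t f := by
  intro ht
  by_cases he : e = 0
  · subst he; simp at h; exact h ht
  · refine h (ht.mul ?_)
    intro r hr hr'
    rw [headIs_unique hr' (headIs_of_zpow s he)] at hr
    exact hf hr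

theorem toWord_mul_zpow_mul {u v : FreeGroup α} {s : α} (hu : ¬ HeadIs s u⁻¹)
    (hv : ¬ HeadIs s v) {m : ℤ} (hm : m ≠ 0) :
    (u * (of s ^ m * v)).toWord = u.toWord ++ ((of s ^ m).toWord ++ v.toWord) := by
  have h1 : ∀ r, HeadIs r (of s ^ m)⁻¹ → ¬ HeadIs r v := by
    intro r hr
    rw [← zpow_neg] at hr
    rw [headIs_unique hr (headIs_of_zpow s (neg_ne_zero.2 hm))]
    exact hv
  have h2 : HeadIs s (of s ^ m * v) := (headIs_of_zpow s hm).mul h1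
  rw [toWord_mul_of_not_headIs, toWord_mul_of_not_headIs h1]
  intro r hr hr'
  rw [headIs_unique hr' h2] at hr
  exact hu hr

theorem norm_lt_norm_conj_zpow_mul {u f : FreeGroup α} {s : α} (hu : ¬ HeadIs s u⁻¹)
    (hf : ¬ HeadIs s (u⁻¹ * f)) {m : ℤ} (hm : m ≠ 0) :
    norm f < norm ((u * of s * u⁻¹) ^ m * f) := by
  have h1 : (u * of s * u⁻¹) ^ m * f = u * (of s ^ m * (u⁻¹ * f)) := by
    rw [conj_zpow]; group
  have h2 := congrArg List.length (toWord_mul_zpow_mul hu hf hm)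
  have h3 := norm_of_zpow_pos s hm
  have h4 := norm_mul_le u (u⁻¹ * f)
  rw [mul_inv_cancel_left] at h4
  rw [h1]
  simp only [List.length_append] at h2
  simp only [norm] at *
  omega

/-- The centralizer of a nontrivial power of a free generator. -/
theorem exists_eq_zpow_of_commute {s : α} {k : ℤ} (hk : k ≠ 0) {f : FreeGroup α}
    (h : Commute f (of s ^ k)) : ∃ e : ℤ, f = of s ^ e := by
  obtain ⟨e, f1, rfl, h1⟩ := exists_zpow_mul_not_headIs s f
  obtain ⟨e2, f2, rfl, h2⟩ := exists_mul_zpow_not_headIs s f1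
  have h3 := not_headIs_of_mul_zpow h2 h1
  have hc : ∀ e : ℤ, Commute (of s ^ e) (of s ^ k) := fun e => (Commute.refl _).zpow_zpow e k
  have h4 : Commute f2 (of s ^ k) := by
    have := (((hc e).inv_left.mul_left h).mul_left (hc e2).inv_left)
    simpa [mul_assoc] using this
  by_cases hf : f2 = 1
  · exact ⟨e + e2, by simp [hf, zpow_add]⟩
  · exfalso
    obtain ⟨r, hr⟩ := exists_headIs hf
    have h5 : HeadIs r (f2 * of s ^ k) := hr.mul (by
      intro t ht ht'
      rw [headIs_unique ht' (headIs_of_zpow s hk)] at ht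
      exact h2 ht)
    rw [h4.eq] at h5
    have h6 : HeadIs s (of s ^ k * f2) := (headIs_of_zpow s hk).mul (by
      intro t ht
      rw [← zpow_neg] at ht
      rw [headIs_unique ht (headIs_of_zpow s (neg_ne_zero.2 hk))]
      exact h3)
    exact h3 (headIs_unique h6 h5 ▸ hr)

/-- Ping-pong for two conjugates of free generators. -/
theorem exists_length_conj_conj {s p : α} {h : FreeGroup α}
    (hne : ¬ Commute (of s) (h * of p * h⁻¹)) :
    ∃ ℓ : FreeGroup α → ℕ, ∀ f,
      (∀ m : ℤ, m ≠ 0 → ℓ f < ℓ ((of s) ^ m * f)) ∨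
      (∀ m : ℤ, m ≠ 0 → ℓ f < ℓ ((h * of p * h⁻¹) ^ m * f)) := by
  obtain ⟨e, h1, rfl, hh1⟩ := exists_zpow_mul_not_headIs s h
  obtain ⟨e2, h2, rfl, hh2⟩ := exists_mul_zpow_not_headIs p h1
  have hh3 := not_headIs_of_mul_zpow hh2 hh1
  have hw : (of s ^ e * (h2 * of p ^ e2)) * of p * (of s ^ e * (h2 * of p ^ e2))⁻¹ =
      of s ^ e * (h2 * of p * h2⁻¹) * (of s ^ e)⁻¹ := by group
  rw [hw] at hne ⊢
  refine ⟨fun f => norm ((of s ^ e)⁻¹ * f), fun f => ?_⟩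
  set f' := (of s ^ e)⁻¹ * f with hf'
  by_cases hx : HeadIs s f'
  · right
    intro m hm
    have h4 : (of s ^ e)⁻¹ * ((of s ^ e * (h2 * of p * h2⁻¹) * (of s ^ e)⁻¹) ^ m * f) =
        (h2 * of p * h2⁻¹) ^ m * f' := by
      rw [conj_zpow (a := of s ^ e), hf']; group
    beta_reduce
    rw [h4]
    refine norm_lt_norm_conj_zpow_mul hh2 ?_ hm
    intro hp
    have h5 : f'.toWord = h2.toWord ++ (h2⁻¹ * f').toWord := by
      conv_lhs => rw [← mul_inv_cancel_left h2 f']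
      apply toWord_mul_of_not_headIs
      intro t ht ht'
      rw [headIs_unique ht' hp] at ht
      exact hh2 ht
    by_cases h6 : h2 = 1
    · subst h6
      simp only [inv_one, one_mul] at hp
      rw [headIs_unique hp hx] at hne
      refine hne ?_
      rw [one_mul, inv_one, mul_one, show of s ^ e * of s * (of s ^ e)⁻¹ = of s by group]
    · obtain ⟨r, b, l, hr⟩ := exists_headIs h6
      have : HeadIs r f' := ⟨b, l ++ (h2⁻¹ * f').toWord, by rw [h5, hr]; rfl⟩
      rw [headIs_unique hx this] at hh3
      exact hh3 ⟨b, l, hr⟩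
  · left
    intro m hm
    have h4 : (of s ^ e)⁻¹ * (of s ^ m * f) = ((1 : FreeGroup α) * of s * 1⁻¹) ^ m * f' := by
      simp only [one_mul, inv_one, mul_one, hf']
      rw [← mul_assoc, ← mul_assoc, ← zpow_neg, ← zpow_add, ← zpow_add, add_comm]
    beta_reduce
    rw [h4]
    exact norm_lt_norm_conj_zpow_mul (by simpa using not_headIs_one s) (by simpa using hx) hm

/-- Ping-pong for a permutation of the free generators and a conjugate of a free generator. -/
theorem exists_length_map_conj {s : α} {v : FreeGroup α} (π : Equiv.Perm α)
    (hne : ∀ m : ℤ, m ≠ 0 →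
      FreeGroup.map (π ^ m : Equiv.Perm α) (v * of s * v⁻¹) ≠ v * of s * v⁻¹) :
    ∃ ℓ : FreeGroup α → ℕ, ∀ f,
      (∀ m : ℤ, m ≠ 0 → ℓ f < ℓ (FreeGroup.map (π ^ m : Equiv.Perm α) f)) ∨
      (∀ m : ℤ, m ≠ 0 → ℓ f < ℓ ((v * of s * v⁻¹) ^ m * f)) := by
  classical
  obtain ⟨e, v1, rfl, hv⟩ := exists_mul_zpow_not_headIs s v
  have hw : (v1 * of s ^ e) * of s * (v1 * of s ^ e)⁻¹ = v1 * of s * v1⁻¹ := by group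
  rw [hw] at hne ⊢
  have hpre : ∀ f, HeadIs s (v1⁻¹ * f) → ∃ b l, f.toWord = v1.toWord ++ (s, b) :: l := by
    intro f hf
    obtain ⟨b, l, hl⟩ := id hf
    refine ⟨b, l, ?_⟩
    conv_lhs => rw [← mul_inv_cancel_left v1 f]
    rw [toWord_mul_of_not_headIs, hl]
    intro t ht ht'
    rw [headIs_unique ht' hf] at ht
    exact hv ht
  have hword : ∀ (m : ℤ) (f : FreeGroup α), (FreeGroup.map (π ^ m : Equiv.Perm α) f).toWord =
      f.toWord.map fun x => ((π ^ m : Equiv.Perm α) x.1, x.2) := by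
    intro m f
    conv_lhs => rw [← mk_toWord (x := f), map.mk, toWord_mk]
    apply IsReduced.reduce_eq
    have h := isReduced_toWord (x := f)
    rw [IsReduced] at h ⊢
    rw [List.isChain_map]
    refine h.imp ?_
    intro a b hab h2
    exact hab ((π ^ m : Equiv.Perm α).injective h2)
  have hnorm : ∀ (m : ℤ) (f : FreeGroup α),
      norm (FreeGroup.map (π ^ m : Equiv.Perm α) f) = norm f := by
    intro m f
    simp [norm, hword]
  refine ⟨fun f => 2 * norm f + if HeadIs s (v1⁻¹ * f) then 0 else 1, fun f => ?_⟩
  by_cases hx : HeadIs s (v1⁻¹ * f)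
  · left
    intro m hm
    have h2 : ¬ HeadIs s (v1⁻¹ * FreeGroup.map (π ^ m : Equiv.Perm α) f) := by
      intro h3
      obtain ⟨b, l, hl⟩ := hpre _ hx
      obtain ⟨b', l', hl'⟩ := hpre _ h3
      rw [hword, hl, List.map_append, List.map_cons] at hl'
      have h4 := List.append_inj hl' (by simp)
      rw [← hword] at h4
      have h5 := toWord_injective h4.1
      have h6 : (π ^ m : Equiv.Perm α) s = s := by
        have := h4.2
        simp only [List.cons.injEq, Prod.mk.injEq] at this
        exact this.1.1
      apply hne m hm
      rw [_root_.map_mul, _root_.map_mul, _root_.map_inv, h5, map.of, h6]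
    simp [hx, h2, hnorm]
  · right
    intro m hm
    have := norm_lt_norm_conj_zpow_mul hv hx hm
    simp only
    split_ifs <;> omega

end FreeGroup

namespace MonoidAlgebra

variable {G : Type*} [Group G]

theorem coeff_of_mul (x g : G) (A : MonoidAlgebra ℤ G) :
    (of ℤ G x * A).coeff g = A.coeff (x⁻¹ * g) := by
  rw [of_apply, coeff_single_mul_apply, one_mul]

theorem eq_zero_of_invariant_line {Q : Type*} (a : Q →₀ ℤ) {f : ℕ → Q}
    (hf : Function.Injective f) (h : ∀ m, a (f (m + 1)) = a (f m)) : a (f 0) = 0 := by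
  by_contra h0
  have h1 : ∀ m, a (f m) = a (f 0) := by
    intro m
    induction m with
    | zero => rfl
    | succ m ih => rw [h, ih]
  refine Set.infinite_of_injective_forall_mem (s := (a.support : Set Q)) hf ?_
    a.support.finite_toSet
  intro m
  simp [h1, h0]

theorem coeff_eq_zero_of_isolated {x g : G} (hx : ∀ m : ℤ, m ≠ 0 → x ^ m ≠ 1)
    {A : MonoidAlgebra ℤ G}
    (h : ∀ m : ℤ, m ≠ 0 → ((of ℤ G x - 1) * A).coeff (x ^ m * g) = 0) :
    ((of ℤ G x - 1) * A).coeff g = 0 := by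
  have hD : ∀ g, ((of ℤ G x - 1) * A).coeff g = A.coeff (x⁻¹ * g) - A.coeff g := by
    intro g
    rw [sub_mul, one_mul, sub_eq_add_neg, ← neg_one_smul ℤ A, coeff_add, Finsupp.add_apply,
      coeff_of_mul, coeff_smul_apply]
    ring_nf
  have hinj : ∀ m m' : ℤ, x ^ m * g = x ^ m' * g → m = m' := by
    intro m m' hm
    by_contra hne
    exact hx (m - m') (sub_ne_zero.2 hne) (by
      rw [zpow_sub, mul_right_cancel hm, mul_inv_cancel])
  have h1 : A.coeff g = 0 := by
    have := eq_zero_of_invariant_line A.coeff (f := fun m : ℕ => x ^ (m : ℤ) * g)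
      (fun m m' hm => by exact_mod_cast hinj _ _ hm) (fun m => by
        have := h ((m + 1 : ℕ) : ℤ) (by omega)
        rw [hD, sub_eq_zero] at this
        rw [← this, ← mul_assoc, ← zpow_neg_one, ← zpow_add]
        congr 3
        push_cast
        ring)
    simpa using this
  have h2 : A.coeff (x⁻¹ * g) = 0 := by
    have := eq_zero_of_invariant_line A.coeff (f := fun m : ℕ => x ^ (-(m : ℤ) - 1) * g)
      (fun m m' hm => by have := hinj _ _ hm; omega) (fun m => by
        have := h (-(m : ℤ) - 1) (by omega)
        rw [hD, sub_eq_zero, ← mul_assoc, ← zpow_neg_one, ← zpow_add] at this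
        rw [← this]
        congr 3
        push_cast
        ring)
    simpa using this
  rw [hD, h1, h2, sub_zero]

theorem eq_zero_of_sub_one_mul_eq_zero {x : G} (hx : ∀ m : ℤ, m ≠ 0 → x ^ m ≠ 1)
    {A : MonoidAlgebra ℤ G} (h : (of ℤ G x - 1) * A = 0) : A = 0 := by
  ext g
  have hinj : ∀ m m' : ℤ, x ^ m * g = x ^ m' * g → m = m' := by
    intro m m' hm
    by_contra hne
    exact hx (m - m') (sub_ne_zero.2 hne) (by
      rw [zpow_sub, mul_right_cancel hm, mul_inv_cancel])
  rw [sub_mul, one_mul, sub_eq_zero] at h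
  have := eq_zero_of_invariant_line A.coeff (f := fun m : ℕ => x ^ (m : ℤ) * g)
    (fun m m' hm => by exact_mod_cast hinj _ _ hm) (fun m => by
      have := coeff_of_mul x (x ^ ((m + 1 : ℕ) : ℤ) * g) A
      rw [h] at this
      rw [this, ← mul_assoc, ← zpow_neg_one, ← zpow_add]
      congr 3
      push_cast
      ring)
  simpa using this

/-- The support argument for two elements playing ping-pong. -/
theorem eq_zero_of_sub_one_mul_eq {x y : G} (hx : ∀ m : ℤ, m ≠ 0 → x ^ m ≠ 1)
    (hy : ∀ m : ℤ, m ≠ 0 → y ^ m ≠ 1) (ℓ : G → ℕ)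
    (hℓ : ∀ g, (∀ m : ℤ, m ≠ 0 → ℓ g < ℓ (x ^ m * g)) ∨ (∀ m : ℤ, m ≠ 0 → ℓ g < ℓ (y ^ m * g)))
    {A C : MonoidAlgebra ℤ G} (h : (of ℤ G x - 1) * A = (of ℤ G y - 1) * C) : A = 0 := by
  apply eq_zero_of_sub_one_mul_eq_zero hx
  by_contra hne
  obtain ⟨g, hg, hmax⟩ := ((of ℤ G x - 1) * A).coeff.support.exists_max_image ℓ
    (Finsupp.support_nonempty_iff.2 (by simpa using hne))
  have key : ∀ g', ℓ g < ℓ g' → ((of ℤ G x - 1) * A).coeff g' = 0 := by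
    intro g' hlt
    by_contra h0
    exact absurd (hmax g' (Finsupp.mem_support_iff.2 h0)) (by omega)
  rw [Finsupp.mem_support_iff] at hg
  rcases hℓ g with h1 | h1
  · exact hg (coeff_eq_zero_of_isolated hx fun m hm => key _ (h1 m hm))
  · rw [h] at hg key
    exact hg (coeff_eq_zero_of_isolated hy fun m hm => key _ (h1 m hm))

theorem exists_of_zpow_sub_one_eq (y : G) (k : ℤ) :
    ∃ C, of ℤ G (y ^ k) - 1 = (of ℤ G y - 1) * C := by
  induction k using Int.induction_on with
  | zero => exact ⟨0, by rw [zpow_zero, map_one, sub_self, mul_zero]⟩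
  | succ k ih =>
    obtain ⟨C, hC⟩ := ih
    refine ⟨C * of ℤ G y + 1, ?_⟩
    rw [zpow_add_one, map_mul, mul_add, ← mul_assoc, ← hC]
    noncomm_ring
  | pred k ih =>
    obtain ⟨C, hC⟩ := ih
    refine ⟨C * of ℤ G y⁻¹ - of ℤ G y⁻¹, ?_⟩
    rw [zpow_sub_one, map_mul, mul_sub, ← mul_assoc, ← hC, sub_mul, sub_mul, ← map_mul,
      ← map_mul, mul_inv_cancel, map_one]
    noncomm_ring

/-- If `x` and `y` commute and are independent, then `(x - 1) A ∈ (y - 1) ℤG` implies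
`A ∈ (y - 1) ℤG`. -/
theorem exists_eq_sub_one_mul {x y : G} (hc : Commute x y)
    (hxy : ∀ (m : ℕ) (k : ℤ), m ≠ 0 → x ^ m ≠ y ^ k)
    {A C : MonoidAlgebra ℤ G} (h : (of ℤ G x - 1) * A = (of ℤ G y - 1) * C) :
    ∃ C', A = (of ℤ G y - 1) * C' := by
  let s := QuotientGroup.rightRel (Subgroup.zpowers y)
  let q : G → Quotient s := Quotient.mk s
  have hq : ∀ a b, q a = q b ↔ ∃ k : ℤ, y ^ k = b * a⁻¹ := by
    intro a b
    rw [Quotient.eq, QuotientGroup.rightRel_apply, Subgroup.mem_zpowers_iff]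
  have hmul : ∀ B : MonoidAlgebra ℤ G, mapDomain q (of ℤ G y * B) = mapDomain q B := by
    intro B
    induction B using induction_linear with
    | zero => simp
    | add a b ha hb => rw [mul_add, mapDomain_add, ha, hb, mapDomain_add]
    | single a r =>
      rw [of_apply, single_mul_single, one_mul, mapDomain_single, mapDomain_single,
        (hq (y * a) a).2 ⟨-1, by group⟩]
  have hrep : ∀ B : MonoidAlgebra ℤ G,
      ∃ C', B - mapDomain Quotient.out (mapDomain q B) = (of ℤ G y - 1) * C' := by
    intro B
    induction B using induction_linear with
    | zero => exact ⟨0, by simp⟩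
    | add a b ha hb =>
      obtain ⟨c, hc⟩ := ha
      obtain ⟨d, hd⟩ := hb
      exact ⟨c + d, by rw [mul_add, ← hc, ← hd, mapDomain_add, mapDomain_add]; abel⟩
    | single a r =>
      have h1 : q (q a).out = q a := Quotient.out_eq _
      obtain ⟨k, hk⟩ := (hq _ _).1 h1
      obtain ⟨c, hc⟩ := exists_of_zpow_sub_one_eq y k
      refine ⟨c * single (q a).out r, ?_⟩
      rw [← mul_assoc, ← hc, hk, mapDomain_single, mapDomain_single, sub_mul, one_mul, of_apply,
        single_mul_single, one_mul, inv_mul_cancel_right]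
  suffices h0 : mapDomain q A = 0 by
    obtain ⟨C', hC'⟩ := hrep A
    exact ⟨C', by rw [← hC', h0, mapDomain_zero, sub_zero]⟩
  have hinv : mapDomain q (of ℤ G x * A) = mapDomain q A := by
    have h1 : of ℤ G x * A + C = of ℤ G y * C + A := by
      rw [sub_mul, sub_mul, one_mul, one_mul] at h
      rw [sub_eq_sub_iff_add_eq_add] at h
      rw [h]
    have h2 := congrArg (mapDomain q) h1
    rw [mapDomain_add, mapDomain_add, hmul, add_comm] at h2
    exact add_left_cancel h2
  have hxq : ∀ a b, q (x * a) = q (x * b) ↔ q a = q b := by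
    intro a b
    rw [hq, hq]
    refine exists_congr fun k => ?_
    have h1 : x * b * (x * a)⁻¹ = x * (b * a⁻¹) * x⁻¹ := by group
    rw [h1, eq_mul_inv_iff_mul_eq, ← (hc.zpow_right k).eq, mul_right_inj]
  let xq : Quotient s → Quotient s := Quotient.map (x * ·) fun a b hab =>
    Quotient.exact ((hxq a b).2 (Quotient.sound hab))
  have hxqi : Function.Injective xq := by
    intro a b
    induction a using Quotient.inductionOn
    induction b using Quotient.inductionOn
    exact (hxq _ _).1
  have hcoeff : ∀ g, (mapDomain q A).coeff (q (x * g)) = (mapDomain q A).coeff (q g) := by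
    intro g
    have h1 : ∀ B : MonoidAlgebra ℤ G,
        mapDomain q (of ℤ G x * B) = mapDomain xq (mapDomain q B) := by
      intro B
      induction B using induction_linear with
      | zero => simp
      | add a b ha hb => rw [mul_add, mapDomain_add, ha, hb, mapDomain_add, mapDomain_add]
      | single a r =>
        rw [of_apply, single_mul_single, one_mul, mapDomain_single, mapDomain_single,
          mapDomain_single]
        rfl
    conv_lhs => rw [← hinv, h1]
    exact Finsupp.mapDomain_apply hxqi _ (q g)
  ext t
  induction t using Quotient.inductionOn with
  | h g =>
  have h1 := eq_zero_of_invariant_line (mapDomain q A).coeff (f := fun m : ℕ => q (x ^ m * g))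
    (by
      have : ∀ m d : ℕ, q (x ^ m * g) = q (x ^ (m + d) * g) → d = 0 := by
        intro m d hm
        obtain ⟨k, hk⟩ := (hq _ _).1 hm
        by_contra hd
        refine hxy d k hd ?_
        rw [hk, pow_add, (Commute.refl x).pow_pow m d]
        group
      intro m m' hm
      rcases le_total m m' with hle | hle
      · obtain ⟨d, rfl⟩ := Nat.exists_eq_add_of_le hle
        rw [this m d hm, add_zero]
      · obtain ⟨d, rfl⟩ := Nat.exists_eq_add_of_le hle
        rw [this m' d hm.symm, add_zero])
    (fun m => by rw [pow_succ', mul_assoc, hcoeff])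
  simpa using h1

end MonoidAlgebra

namespace MonoidAlgebra

variable {G S I : Type*} [Group G] [Monoid S]

/-- Sum of the coefficients. -/
noncomputable def augmentation (G : Type*) [Group G] : MonoidAlgebra ℤ G →ₐ[ℤ] ℤ :=
  MonoidAlgebra.lift ℤ ℤ G 1

theorem augmentation_of (g : G) : augmentation G (of ℤ G g) = 1 := by
  simp [augmentation]

/-- A homomorphism from a monoid `S` generated by a copy of a group `G` and elements `δ i` to the
group ring `ℤG`, sending `δ i` to `s i - 1`, is injective provided that the conjugates of the
`s i` and of the `δ i` satisfy the same equalities and commutations, and that noncommuting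
conjugates of the `s i` satisfy an independence condition in the group ring. -/
theorem injective_of_conjugates (j : G →* S) (δ : I → S) (s : I → G)
    (ψ : S →* MonoidAlgebra ℤ G)
    (hgen : Submonoid.closure (Set.range j ∪ Set.range δ) = ⊤)
    (hψj : ∀ g, ψ (j g) = of ℤ G g) (hψδ : ∀ i, ψ (δ i) = of ℤ G (s i) - 1)
    (deg : G →* Multiplicative ℤ) (hdeg : ∀ i, deg (s i) = Multiplicative.ofAdd 2)
    (hpow : ∀ b i c k, ∀ m : ℕ, m ≠ 0 →
      (b * s i * b⁻¹) ^ m = (c * s k * c⁻¹) ^ m → b * s i * b⁻¹ = c * s k * c⁻¹)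
    (heq : ∀ b i c k, b * s i * b⁻¹ = c * s k * c⁻¹ →
      j b * δ i * j b⁻¹ = j c * δ k * j c⁻¹)
    (hcomm : ∀ b i c k, Commute (b * s i * b⁻¹) (c * s k * c⁻¹) →
      Commute (j b * δ i * j b⁻¹) (j c * δ k * j c⁻¹))
    (hindep : ∀ b i c k, ¬ Commute (b * s i * b⁻¹) (c * s k * c⁻¹) →
      ∀ A C, (of ℤ G (b * s i * b⁻¹) - 1) * A = (of ℤ G (c * s k * c⁻¹) - 1) * C → A = 0) :
    Function.Injective ψ := by
  set d : G × I → S := fun p => j p.1 * δ p.2 * j p.1⁻¹ with hd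
  set x : G × I → G := fun p => p.1 * s p.2 * p.1⁻¹ with hx
  set P : List (G × I) → S := fun L => (L.map d).prod with hP
  set E : List (G × I) → MonoidAlgebra ℤ G := fun L => (L.map fun p => of ℤ G (x p) - 1).prod
    with hE
  have hPc : ∀ p L, P (p :: L) = d p * P L := fun p L => by simp [hP]
  have hEc : ∀ p L, E (p :: L) = (of ℤ G (x p) - 1) * E L := fun p L => by simp [hE]
  have hdx : ∀ p m, deg (x p ^ (m : ℤ)) = Multiplicative.ofAdd (2 * m) := by
    intro p m
    rw [map_zpow, hx, map_mul, map_mul, hdeg, map_inv, mul_inv_cancel_comm, ← ofAdd_zsmul,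
      smul_eq_mul, mul_comm]
  have hinf : ∀ p, ∀ m : ℤ, m ≠ 0 → x p ^ m ≠ 1 := by
    intro p m hm h
    have := hdx p m
    rw [h, map_one, ← ofAdd_zero, Multiplicative.ofAdd.injective.eq_iff] at this
    omega
  have hψd : ∀ p, ψ (d p) = of ℤ G (x p) - 1 := by
    intro p
    rw [hd, map_mul, map_mul, hψj, hψδ, hψj, mul_sub, sub_mul, mul_one, ← map_mul, ← map_mul,
      ← map_mul, mul_inv_cancel, map_one]
  have hψP : ∀ L, ψ (P L) = E L := by
    intro L
    induction L with
    | nil => simp [hP, hE]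
    | cons p L ih => rw [hPc, hEc, map_mul, hψd, ih]
  have hEne : ∀ L, E L ≠ 0 := by
    intro L
    induction L with
    | nil => simp [hE]
    | cons p L ih =>
      rw [hEc]
      exact fun h => ih (eq_zero_of_sub_one_mul_eq_zero (hinf p) h)
  have haug : ∀ p A, augmentation G ((of ℤ G (x p) - 1) * A) = 0 := by
    intro p A
    rw [map_mul, map_sub, augmentation_of, map_one, sub_self, zero_mul]
  have hdiv : ∀ L q C, E L = (of ℤ G (x q) - 1) * C → ∃ L', P L = d q * P L' := by
    intro L
    induction L with
    | nil =>
      intro q C h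
      have h1 := congrArg (augmentation G) h
      rw [haug] at h1
      simp [hE] at h1
    | cons p L ih =>
      intro q C h
      rw [hEc] at h
      by_cases hc : Commute (x p) (x q)
      · by_cases hpq : x p = x q
        · exact ⟨L, by rw [hPc, show d p = d q from heq _ _ _ _ hpq]⟩
        · obtain ⟨C', hC'⟩ := exists_eq_sub_one_mul hc (by
            intro m k hm hmk
            have h1 := hdx p m
            rw [zpow_natCast, hmk, hdx, Multiplicative.ofAdd.injective.eq_iff] at h1
            have h2 : k = m := by omega
            rw [h2, zpow_natCast] at hmk
            exact hpq (hpow _ _ _ _ m hm hmk)) h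
          obtain ⟨L', hL'⟩ := ih q C' hC'
          refine ⟨p :: L', ?_⟩
          have h1 : Commute (d p) (d q) := hcomm _ _ _ _ hc
          rw [hPc, hPc, hL', ← mul_assoc (d p), h1.eq, mul_assoc (d q)]
      · exact absurd (hindep _ _ _ _ hc _ _ h) (hEne L)
  have hmain : ∀ L' L g g', E L * of ℤ G g = E L' * of ℤ G g' → P L * j g = P L' * j g' := by
    intro L'
    induction L' with
    | nil =>
      intro L g g' h
      cases L with
      | nil =>
        have : (of ℤ G g) = of ℤ G g' := by simpa [hE] using h
        rw [of_injective this]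
      | cons p L =>
        exfalso
        have h1 := congrArg (augmentation G) h
        rw [hEc, mul_assoc, haug] at h1
        simp [hE, augmentation_of, -of_apply] at h1
    | cons q L' ih =>
      intro L g g' h
      rw [hEc, mul_assoc] at h
      have h1 : E L = (of ℤ G (x q) - 1) * (E L' * of ℤ G g' * of ℤ G g⁻¹) := by
        rw [← mul_assoc, ← h, mul_assoc, ← map_mul, mul_inv_cancel, map_one, mul_one]
      obtain ⟨L1, hL1⟩ := hdiv _ _ _ h1
      have h2 : E L = (of ℤ G (x q) - 1) * E L1 := by
        rw [← hψP, hL1, map_mul, hψd, hψP]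
      rw [hL1, hPc, mul_assoc (d q), mul_assoc (d q), ih L1 g g']
      rw [h2, mul_assoc, ← sub_eq_zero, ← mul_sub] at h
      exact sub_eq_zero.1 (eq_zero_of_sub_one_mul_eq_zero (hinf q) h)
  have hnf : ∀ t : S, ∃ L g, t = P L * j g := by
    intro t
    have ht : t ∈ Submonoid.closure (Set.range j ∪ Set.range δ) := hgen ▸ Submonoid.mem_top t
    induction ht using Submonoid.closure_induction_left with
    | one => exact ⟨[], 1, by simp [hP]⟩
    | mul_left a ha b hb ih =>
      obtain ⟨L, g, rfl⟩ := ih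
      rcases ha with ⟨c, rfl⟩ | ⟨i, rfl⟩
      · refine ⟨L.map fun p => (c * p.1, p.2), c * g, ?_⟩
        rw [map_mul, ← mul_assoc, ← mul_assoc]
        congr 1
        clear hb
        induction L with
        | nil => simp [hP]
        | cons p L ih =>
          rw [hPc, List.map_cons, hPc, mul_assoc _ _ (j c), ← ih, hd]
          simp only [mul_inv_rev, map_mul]
          simp only [mul_assoc]
          rw [← mul_assoc (j c⁻¹) (j c), ← map_mul, inv_mul_cancel, map_one, one_mul]
      · exact ⟨(1, i) :: L, g, by rw [hPc, hd]; simp [mul_assoc]⟩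
  intro t t' h
  obtain ⟨L, g, rfl⟩ := hnf t
  obtain ⟨L', g', rfl⟩ := hnf t'
  apply hmain
  rw [map_mul, map_mul, hψP, hψP, hψj, hψj] at h
  exact h

end MonoidAlgebra

namespace Braid

/-- The braid group with `N` Artin generators, acting on the strands `0, …, N`. -/
abbrev Bd (N : ℕ) : Type := BraidGroup (N + 1)

/-- The `i`-th Artin generator of the braid group (trivial if out of range). -/
def sg (N i : ℕ) : Bd N := if h : i < N then PresentedGroup.of (⟨i, h⟩ : Fin N) else 1

theorem sg_of_lt {N i : ℕ} (h : i < N) : sg N i = PresentedGroup.of (⟨i, h⟩ : Fin N) := dif_pos h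

theorem sg_comm {N i j : ℕ} (h : i + 2 ≤ j) : Commute (sg N i) (sg N j) := by
  by_cases hj : j < N
  · rw [sg_of_lt hj, sg_of_lt (by omega : i < N)]
    have := PresentedGroup.one_of_mem (rels := braidRels (N + 1))
      (Or.inl ⟨(⟨i, by omega⟩ : Fin N), (⟨j, hj⟩ : Fin N), h, rfl⟩)
    rw [map_mul, map_inv, mul_inv_eq_one, map_mul, map_mul] at this
    exact this
  · simp [sg, hj]

theorem sg_braid {N i : ℕ} (h : i + 1 < N) :
    sg N i * sg N (i + 1) * sg N i = sg N (i + 1) * sg N i * sg N (i + 1) := by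
  rw [sg_of_lt h, sg_of_lt (by omega : i < N)]
  have := PresentedGroup.one_of_mem (rels := braidRels (N + 1))
    (Or.inr ⟨(⟨i, by omega⟩ : Fin N), (⟨i + 1, h⟩ : Fin N), rfl, rfl⟩)
  rw [map_mul, map_inv, mul_inv_eq_one, map_mul, map_mul, map_mul, map_mul] at this
  exact this

theorem closure_sg (N : ℕ) : Subgroup.closure {g | ∃ i < N, g = sg N i} = ⊤ := by
  rw [← PresentedGroup.closure_range_of]
  congr 1
  ext g
  constructor
  · rintro ⟨i, hi, rfl⟩
    exact ⟨⟨i, hi⟩, (sg_of_lt hi).symm⟩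
  · rintro ⟨⟨i, hi⟩, rfl⟩
    exact ⟨i, hi, (sg_of_lt hi).symm⟩

theorem bd_induction {N : ℕ} {p : Bd N → Prop} (one : p 1) (mul : ∀ a b, p a → p b → p (a * b))
    (inv : ∀ a, p a → p a⁻¹) (gen : ∀ i < N, p (sg N i)) (b : Bd N) : p b := by
  have hb : b ∈ Subgroup.closure {g | ∃ i < N, g = sg N i} := by rw [closure_sg]; trivial
  induction hb using Subgroup.closure_induction with
  | mem x hx => obtain ⟨i, hi, rfl⟩ := hx; exact gen i hi
  | one => exact one
  | mul x y _ _ hx hy => exact mul x y hx hy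
  | inv x _ hx => exact inv x hx

theorem mem_of_gen {N : ℕ} {H : Subgroup (Bd N)} (gen : ∀ i < N, sg N i ∈ H) (b : Bd N) :
    b ∈ H :=
  bd_induction H.one_mem (fun _ _ => H.mul_mem) (fun _ => H.inv_mem) gen b

/-- The homomorphism from a braid group determined by the images of the generators. -/
def bdLift {H : Type*} [Group H] (N : ℕ) (f : ℕ → H)
    (hc : ∀ i j, i + 2 ≤ j → j < N → f i * f j = f j * f i)
    (hb : ∀ i, i + 1 < N → f i * f (i + 1) * f i = f (i + 1) * f i * f (i + 1)) : Bd N →* H :=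
  PresentedGroup.toGroup (rels := braidRels (N + 1)) (f := fun i : Fin (N + 1 - 1) => f i.1) (by
    rintro w (⟨i, k, h, rfl⟩ | ⟨i, k, h, rfl⟩)
    · simp only [map_mul, map_inv, FreeGroup.lift_apply_of, mul_inv_eq_one]
      exact hc _ _ h k.2
    · simp only [map_mul, map_inv, FreeGroup.lift_apply_of, mul_inv_eq_one]
      rw [← h]
      exact hb _ (h ▸ k.2))

theorem bdLift_sg {H : Type*} [Group H] {N : ℕ} {f : ℕ → H} (hc hb) {i : ℕ} (hi : i < N) :
    bdLift N f hc hb (sg N i) = f i := by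
  rw [sg_of_lt hi, bdLift]
  exact PresentedGroup.toGroup.of _

/-- The degree of a braid. -/
def deg (N : ℕ) : Bd N →* Multiplicative ℤ :=
  bdLift N (fun _ => Multiplicative.ofAdd (1 : ℤ)) (fun _ _ _ _ => rfl) (fun _ _ => rfl)

theorem deg_sg {N i : ℕ} (hi : i < N) : deg N (sg N i) = Multiplicative.ofAdd (1 : ℤ) :=
  bdLift_sg _ _ hi

theorem sg_zpow_ne_one {N i : ℕ} (hi : i < N) {m : ℤ} (hm : m ≠ 0) : sg N i ^ m ≠ 1 := by
  intro h
  have := congrArg (deg N) h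
  rw [map_zpow, deg_sg hi, map_one (deg N), ← ofAdd_zsmul, ← ofAdd_zero,
    Multiplicative.ofAdd.injective.eq_iff] at this
  simp at this
  exact hm this

/-- The permutation of the strands. -/
def perm (N : ℕ) : Bd N →* Equiv.Perm ℕ :=
  bdLift N (fun i => Equiv.swap i (i + 1))
    (fun i j h _ => by
      ext k
      simp only [Equiv.Perm.mul_apply, Equiv.swap_apply_def]
      grind)
    (fun i _ => by
      ext k
      simp only [Equiv.Perm.mul_apply, Equiv.swap_apply_def]
      grind)

theorem perm_sg {N i : ℕ} (hi : i < N) : perm N (sg N i) = Equiv.swap i (i + 1) :=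
  bdLift_sg _ _ hi

theorem perm_fix_of_lt {N : ℕ} (b : Bd N) : ∀ k, N < k → perm N b k = k := by
  induction b using bd_induction with
  | one => simp
  | mul a b ha hb => intro k hk; rw [map_mul, Equiv.Perm.mul_apply, hb k hk, ha k hk]
  | inv a ha => intro k hk; rw [map_inv, Equiv.Perm.inv_eq_iff_eq, ha k hk]
  | gen i hi =>
    intro k hk
    rw [perm_sg hi, Equiv.swap_apply_of_ne_of_ne] <;> omega

theorem perm_le {N : ℕ} (b : Bd N) {k : ℕ} (hk : k ≤ N) : perm N b k ≤ N := by
  by_contra h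
  have := perm_fix_of_lt b _ (not_le.1 h)
  have := (perm N b).injective this
  omega

/-- The standard inclusion of braid groups. -/
def incl (M : ℕ) : Bd M →* Bd (M + 1) :=
  bdLift M (sg (M + 1)) (fun _ _ h _ => sg_comm h) (fun _ h => sg_braid (by omega))

theorem incl_sg {M i : ℕ} (hi : i < M) : incl M (sg M i) = sg (M + 1) i := bdLift_sg _ _ hi

section words

variable {S : Type*} [Monoid S] {a b : S}

theorem braid_sq (h : a * b * a = b * a * b) : a * b * (a * a) = b * b * (a * b) := by
  calc a * b * (a * a) = a * b * a * a := by simp only [mul_assoc]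
    _ = b * a * b * a := by rw [h]
    _ = b * (a * b * a) := by simp only [mul_assoc]
    _ = b * b * (a * b) := by rw [h]; simp only [mul_assoc]

theorem braid_double (h : a * b * a = b * a * b) :
    a * (b * b) * a * (b * b) = b * b * a * (b * b) * a := by
  calc a * (b * b) * a * (b * b) = a * b * (b * a * b) * b := by simp only [mul_assoc]
    _ = a * b * (a * b * a) * b := by rw [h]
    _ = a * b * a * (b * a * b) := by simp only [mul_assoc]
    _ = b * a * b * (a * b * a) := by rw [h]
    _ = b * (a * b * a) * (b * a) := by simp only [mul_assoc]
    _ = b * b * a * (b * b) * a := by rw [h]; simp only [mul_assoc]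

end words

/-- The braid `σ_M σ_{M-1} ⋯ σ_k`, carrying the last strand to position `k`. -/
def tl (M k : ℕ) : Bd (M + 1) :=
  ((List.range (M + 1 - k)).map fun j => sg (M + 1) (M - j)).prod

theorem tl_top (M : ℕ) : tl M (M + 1) = 1 := by simp [tl]

theorem tl_succ {M k : ℕ} (h : k ≤ M) : tl M k = tl M (k + 1) * sg (M + 1) k := by
  rw [tl, tl, show M + 1 - k = (M + 1 - (k + 1)) + 1 by omega, List.range_succ, List.map_append,
    List.prod_append]
  simp [show M - (M - k) = k by omega]

theorem down_induction {M : ℕ} {p : ℕ → Prop} (top : p M) (step : ∀ k < M, p (k + 1) → p k) :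
    ∀ k ≤ M, p k := by
  intro k hk
  induction hk using Nat.decreasingInduction with
  | self => exact top
  | of_succ k hk ih => exact step k hk ih

theorem tl_comm {M i k : ℕ} (hk : k ≤ M + 1) (h : i + 1 < k) :
    Commute (tl M k) (sg (M + 1) i) := by
  revert h
  refine down_induction (p := fun k => i + 1 < k → Commute (tl M k) (sg (M + 1) i)) ?_ ?_ k hk
  · intro _
    rw [tl_top]
    exact Commute.one_left _
  · intro k hk ih h
    rw [tl_succ (by omega)]
    exact (ih (by omega)).mul_left (sg_comm (by omega)).symm

theorem tl_shift {M i k : ℕ} (hk : k ≤ i) (hi : i + 1 ≤ M) :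
    tl M k * sg (M + 1) (i + 1) = sg (M + 1) i * tl M k := by
  refine down_induction (M := i)
    (p := fun k => tl M k * sg (M + 1) (i + 1) = sg (M + 1) i * tl M k) ?_ ?_ k hk
  · rw [tl_succ (by omega : i ≤ M), tl_succ hi]
    have h1 := (tl_comm (M := M) (i := i) (k := i + 1 + 1) (by omega) (by omega)).eq
    have h2 := sg_braid (N := M + 1) (i := i) (by omega)
    calc _ = tl M (i + 1 + 1) * (sg (M + 1) (i + 1) * sg (M + 1) i * sg (M + 1) (i + 1)) := by
          simp only [mul_assoc]
      _ = _ := by rw [← h2]; simp only [← mul_assoc]; rw [h1]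
  · intro k hk ih
    rw [tl_succ (by omega), mul_assoc, (sg_comm (by omega : k + 2 ≤ i + 1)).eq, ← mul_assoc, ih,
      mul_assoc]

/-- The pure braid generators of the fibre. -/
def pg (M i : ℕ) : Bd (M + 1) :=
  tl M (i + 1) * (sg (M + 1) i * sg (M + 1) i) * (tl M (i + 1))⁻¹

theorem pg_last (M : ℕ) : pg M M = sg (M + 1) M * sg (M + 1) M := by
  rw [pg, tl_top]; group

theorem sg_pg {M i : ℕ} (h : i < M) : sg (M + 1) i * pg M i = pg M (i + 1) * sg (M + 1) i := by
  have h1 := (tl_comm (M := M) (i := i) (k := i + 1 + 1) (by omega) (by omega)).eq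
  have h2 := braid_sq (sg_braid (N := M + 1) (i := i) (by omega))
  rw [pg, pg, tl_succ (by omega : i + 1 ≤ M)]
  generalize tl M (i + 1 + 1) = t at *
  generalize sg (M + 1) (i + 1) = b at *
  generalize sg (M + 1) i = a at *
  have h3 : t⁻¹ * a = a * t⁻¹ := by
    rw [inv_mul_eq_iff_eq_mul, ← mul_assoc, h1, mul_inv_cancel_right]
  calc a * (t * b * (a * a) * (t * b)⁻¹) = (a * t) * (b * (a * a)) * b⁻¹ * t⁻¹ := by group
    _ = t * (a * b * (a * a)) * b⁻¹ * t⁻¹ := by rw [← h1]; group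
    _ = t * (b * b) * (a * t⁻¹) := by rw [h2]; group
    _ = _ := by rw [← h3]; group

theorem sg_comm_pg {M i j : ℕ} (hj : j < M) (hi : i ≤ M) (h1 : j ≠ i) (h2 : j + 1 ≠ i) :
    Commute (sg (M + 1) j) (pg M i) := by
  rcases lt_or_gt_of_ne h1 with h | h
  · have h3 := tl_comm (M := M) (i := j) (k := i + 1) (by omega) (by omega)
    have h4 := sg_comm (N := M + 1) (by omega : j + 2 ≤ i)
    exact ((h3.symm.mul_right (h4.mul_right h4)).mul_right h3.symm.inv_right)
  · have h3 := tl_shift (M := M) (k := i + 1) (i := j) (by omega) (by omega)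
    have h4 := sg_comm (N := M + 1) (by omega : i + 2 ≤ j + 1)
    have h5 : sg (M + 1) j = tl M (i + 1) * sg (M + 1) (j + 1) * (tl M (i + 1))⁻¹ := by
      rw [h3, mul_inv_cancel_right]
    rw [pg, h5, commute_iff_eq]
    have h6 := (h4.mul_left h4).eq
    have : ∀ t u v : Bd (M + 1), t * u * t⁻¹ * (t * v * t⁻¹) = t * (u * v) * t⁻¹ := by
      intros; group
    rw [this, this, h6]

theorem sg_pg_double {M i : ℕ} (h : i < M) :
    sg (M + 1) i * pg M (i + 1) * sg (M + 1) i * pg M (i + 1) =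
      pg M (i + 1) * sg (M + 1) i * pg M (i + 1) * sg (M + 1) i := by
  have h1 := (tl_comm (M := M) (i := i) (k := i + 1 + 1) (by omega) (by omega)).eq
  have h2 := braid_double (sg_braid (N := M + 1) (i := i) (by omega))
  rw [pg]
  generalize tl M (i + 1 + 1) = t at *
  generalize sg (M + 1) (i + 1) = b at *
  have h3 : sg (M + 1) i = t * sg (M + 1) i * t⁻¹ := by rw [h1, mul_inv_cancel_right]
  rw [h3]
  generalize sg (M + 1) i = a at *
  have h4 : ∀ u v : Bd (M + 1), t * u * t⁻¹ * (t * v * t⁻¹) = t * (u * v) * t⁻¹ := by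
    intros; group
  simp only [h4, h2]

/-- The pure braid generators satisfy the relations of the Artin action. -/
theorem sg_pg_conj {M i : ℕ} (h : i < M) :
    sg (M + 1) i * pg M (i + 1) * (sg (M + 1) i)⁻¹ =
      (pg M (i + 1))⁻¹ * pg M i * pg M (i + 1) := by
  have h1 := sg_pg h
  have h2 := sg_pg_double h
  have h3 : pg M i = (sg (M + 1) i)⁻¹ * pg M (i + 1) * sg (M + 1) i := by
    rw [mul_assoc, ← h1, inv_mul_cancel_left]
  rw [h3]
  generalize pg M (i + 1) = Y at *
  generalize sg (M + 1) i = a at *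
  rw [mul_inv_eq_iff_eq_mul]
  apply mul_left_cancel (a := a * Y)
  rw [show a * Y * (a * Y) = a * Y * a * Y by group, h2]
  rw [show a * Y * (Y⁻¹ * (a⁻¹ * Y * a) * Y * a) = Y * a * Y * a by group]

/-- The `i`-th generator of the fibre (trivial if out of range). -/
def xl (M i : ℕ) : FreeGroup (Fin (M + 1)) :=
  if h : i < M + 1 then FreeGroup.of ⟨i, h⟩ else 1

theorem xl_of_lt {M i : ℕ} (h : i < M + 1) : xl M i = FreeGroup.of ⟨i, h⟩ := dif_pos h

theorem of_eq_xl {M : ℕ} (i : Fin (M + 1)) : FreeGroup.of i = xl M i := (xl_of_lt i.2).symm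

theorem hom_ext_xl {M : ℕ} {H : Type*} [Group H] {f g : FreeGroup (Fin (M + 1)) →* H}
    (h : ∀ i ≤ M, f (xl M i) = g (xl M i)) : f = g := by
  ext i
  rw [of_eq_xl]
  exact h i (by omega)

/-- The action of a generator on the fibre. -/
def artinHom (M k : ℕ) : FreeGroup (Fin (M + 1)) →* FreeGroup (Fin (M + 1)) :=
  FreeGroup.lift fun j =>
    if (j : ℕ) = k then xl M (k + 1)
    else if (j : ℕ) = k + 1 then (xl M (k + 1))⁻¹ * xl M k * xl M (k + 1) else xl M j

/-- The action of the inverse of a generator on the fibre. -/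
def artinInv (M k : ℕ) : FreeGroup (Fin (M + 1)) →* FreeGroup (Fin (M + 1)) :=
  FreeGroup.lift fun j =>
    if (j : ℕ) = k then xl M k * xl M (k + 1) * (xl M k)⁻¹
    else if (j : ℕ) = k + 1 then xl M k else xl M j

theorem artinHom_xl {M k : ℕ} (hk : k < M) (j : ℕ) : artinHom M k (xl M j) =
    if j = k then xl M (k + 1)
    else if j = k + 1 then (xl M (k + 1))⁻¹ * xl M k * xl M (k + 1) else xl M j := by
  by_cases hj : j < M + 1
  · rw [xl_of_lt hj, artinHom, FreeGroup.lift_apply_of, ← xl_of_lt hj]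
  · rw [if_neg (by omega), if_neg (by omega), xl, dif_neg hj, map_one]

theorem artinInv_xl {M k : ℕ} (hk : k < M) (j : ℕ) : artinInv M k (xl M j) =
    if j = k then xl M k * xl M (k + 1) * (xl M k)⁻¹
    else if j = k + 1 then xl M k else xl M j := by
  by_cases hj : j < M + 1
  · rw [xl_of_lt hj, artinInv, FreeGroup.lift_apply_of, ← xl_of_lt hj]
  · rw [if_neg (by omega), if_neg (by omega), xl, dif_neg hj, map_one]

/-- The Artin automorphism given by a generator (trivial if out of range). -/
def artin (M k : ℕ) : MulAut (FreeGroup (Fin (M + 1))) :=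
  if h : k < M then
    MonoidHom.toMulEquiv (artinHom M k) (artinInv M k)
      (hom_ext_xl fun i _ => by
        rw [MonoidHom.comp_apply, artinHom_xl h, MonoidHom.id_apply]
        split_ifs <;> simp_all [artinInv_xl h, mul_assoc])
      (hom_ext_xl fun i _ => by
        rw [MonoidHom.comp_apply, artinInv_xl h, MonoidHom.id_apply]
        split_ifs <;> simp_all [artinHom_xl h, mul_assoc])
  else 1

theorem artin_xl {M k : ℕ} (hk : k < M) (j : ℕ) : artin M k (xl M j) =
    if j = k then xl M (k + 1)
    else if j = k + 1 then (xl M (k + 1))⁻¹ * xl M k * xl M (k + 1) else xl M j := by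
  rw [← artinHom_xl hk, artin, dif_pos hk]
  rfl

theorem mulAut_ext_xl {M : ℕ} {f g : MulAut (FreeGroup (Fin (M + 1)))}
    (h : ∀ i ≤ M, f (xl M i) = g (xl M i)) : f = g := by
  have := hom_ext_xl (f := f.toMonoidHom) (g := g.toMonoidHom) h
  exact MulEquiv.toMonoidHom_injective this

/-- The Artin action of the braid group on the fibre. -/
def art (M : ℕ) : Bd M →* MulAut (FreeGroup (Fin (M + 1))) :=
  bdLift M (artin M)
    (fun i j h hj => mulAut_ext_xl fun l _ => by
      have hi : i < M := by omega
      rw [MulAut.mul_apply, MulAut.mul_apply, artin_xl hi, artin_xl hj]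
      split_ifs <;> simp only [artin_xl hi, artin_xl hj, map_mul, map_inv] <;> grind)
    (fun i hi => mulAut_ext_xl fun l _ => by
      have hi' : i < M := by omega
      rw [MulAut.mul_apply, MulAut.mul_apply, MulAut.mul_apply, MulAut.mul_apply, artin_xl hi,
        artin_xl hi']
      have e1 : i ≠ i + 1 + 1 := by omega
      by_cases h1 : l = i
      · subst h1
        simp [artin_xl hi, artin_xl hi', e1, e1.symm]
      by_cases h2 : l = i + 1
      · subst h2
        simp [artin_xl hi, artin_xl hi', e1, e1.symm]
      by_cases h3 : l = i + 1 + 1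
      · subst h3
        simp [artin_xl hi, artin_xl hi', e1, e1.symm, mul_assoc]
      · simp [artin_xl hi, artin_xl hi', h1, h2, h3])

theorem art_sg_xl {M k : ℕ} (hk : k < M) (j : ℕ) : art M (sg M k) (xl M j) =
    if j = k then xl M (k + 1)
    else if j = k + 1 then (xl M (k + 1))⁻¹ * xl M k * xl M (k + 1) else xl M j := by
  rw [art, bdLift_sg _ _ hk, artin_xl hk]

/-- The semidirect product of the fibre and the braid group on one strand fewer. -/
abbrev Sd (M : ℕ) : Type := FreeGroup (Fin (M + 1)) ⋊[art M] Bd M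

open SemidirectProduct

/-- The images of the elements of the fibre. -/
def fibre (M : ℕ) : FreeGroup (Fin (M + 1)) →* Bd (M + 1) := FreeGroup.lift fun j => pg M j

theorem fibre_xl {M j : ℕ} (hj : j ≤ M) : fibre M (xl M j) = pg M j := by
  rw [xl_of_lt (by omega), fibre, FreeGroup.lift_apply_of]

theorem fibre_art {M : ℕ} (b : Bd M) :
    ∀ f, fibre M (art M b f) = incl M b * fibre M f * (incl M b)⁻¹ := by
  induction b using bd_induction with
  | one => simp
  | mul a b ha hb => intro f; rw [map_mul, MulAut.mul_apply, ha, hb, map_mul]; group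
  | inv a ha =>
    intro f
    have := ha (art M a⁻¹ f)
    rw [← MulAut.mul_apply, ← map_mul, mul_inv_cancel, map_one, MulAut.one_apply] at this
    rw [this, map_inv (incl M)]
    group
  | gen i hi =>
    intro f
    have : (fibre M).comp (art M (sg M i)).toMonoidHom =
        (MulAut.conj (incl M (sg M i))).toMonoidHom.comp (fibre M) := hom_ext_xl fun j hj => by
      simp only [MonoidHom.comp_apply, MulEquiv.coe_toMonoidHom, MulAut.conj_apply]
      rw [art_sg_xl hi, incl_sg hi, fibre_xl hj]
      by_cases h1 : j = i
      · subst h1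
        rw [if_pos rfl, fibre_xl (by omega), eq_mul_inv_iff_mul_eq, sg_pg hi]
      by_cases h2 : j = i + 1
      · subst h2
        rw [if_neg h1, if_pos rfl, map_mul, map_mul, map_inv, fibre_xl (by omega),
          fibre_xl (by omega), sg_pg_conj hi]
      · rw [if_neg h1, if_neg h2, fibre_xl hj, eq_mul_inv_iff_mul_eq]
        exact (sg_comm_pg hi hj (Ne.symm h1) (Ne.symm h2)).eq.symm
    exact DFunLike.congr_fun this f

/-- The semidirect product as the stabilizer of the last strand. -/
def iota (M : ℕ) : Sd M →* Bd (M + 1) :=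
  SemidirectProduct.lift (fibre M) (incl M) fun g => by
    ext1 i
    exact fibre_art g _

theorem iota_inl {M : ℕ} (f : FreeGroup (Fin (M + 1))) : iota M (inl f) = fibre M f :=
  SemidirectProduct.lift_inl ..

theorem iota_inr {M : ℕ} (b : Bd M) : iota M (inr b) = incl M b :=
  SemidirectProduct.lift_inr ..

theorem art_xl_eq_conj {M : ℕ} (b : Bd M) :
    ∀ j ≤ M, ∃ h, art M b (xl M j) = h * xl M (perm M b j) * h⁻¹ := by
  induction b using bd_induction with
  | one => exact fun j _ => ⟨1, by simp⟩
  | mul a b ha hb =>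
    intro j hj
    obtain ⟨h, hh⟩ := hb j hj
    obtain ⟨h', hh'⟩ := ha _ (perm_le b hj)
    refine ⟨art M a h * h', ?_⟩
    rw [map_mul, MulAut.mul_apply, hh, map_mul, map_mul, map_inv, hh', map_mul,
      Equiv.Perm.mul_apply]
    group
  | inv a ha =>
    intro j hj
    obtain ⟨h, hh⟩ := ha _ (perm_le a⁻¹ hj)
    rw [← Equiv.Perm.mul_apply, ← map_mul, mul_inv_cancel, map_one, Equiv.Perm.one_apply] at hh
    refine ⟨((art M a)⁻¹ h)⁻¹, ?_⟩
    rw [map_inv (art M)]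
    apply (art M a).injective
    rw [map_mul, map_mul, map_inv, hh, inv_inv]
    simp only [MulAut.apply_inv_self]
    group
  | gen i hi =>
    intro j hj
    rw [art_sg_xl hi, perm_sg hi, Equiv.swap_apply_def]
    split_ifs
    · exact ⟨1, by simp⟩
    · exact ⟨(xl M (i + 1))⁻¹, by simp⟩
    · exact ⟨1, by simp⟩

theorem inr_mul_inl {M : ℕ} (b : Bd M) (f : FreeGroup (Fin (M + 1))) :
    (inr b : Sd M) * inl f = inl (art M b f) * inr b := by
  rw [inl_aut, map_inv, inv_mul_cancel_right]

/-- The cocycle describing right multiplication by a generator on cosets of the stabilizer of the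
last strand. -/
def av (M i k : ℕ) : Sd M :=
  if k = i then inl (xl M i) else if k = i + 1 then 1
  else if i + 1 < k then (if k ≤ M + 1 then inr (sg M i) else 1) else inr (sg M (i - 1))

theorem av_self (M i : ℕ) : av M i i = inl (xl M i) := if_pos rfl

theorem av_succ (M i : ℕ) : av M i (i + 1) = 1 := by simp [av]

theorem av_gt {M i k : ℕ} (h : i + 1 < k) (hk : k ≤ M + 1) : av M i k = inr (sg M i) := by
  rw [av, if_neg (by omega), if_neg (by omega), if_pos h, if_pos hk]

theorem av_out {M i k : ℕ} (h : i + 1 < k) (hk : M + 1 < k) : av M i k = 1 := by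
  rw [av, if_neg (by omega), if_neg (by omega), if_pos h, if_neg (by omega)]

theorem av_lt {M i k : ℕ} (h : k ≤ i) : av M (i + 1) k = inr (sg M i) := by
  rw [av, if_neg (by omega), if_neg (by omega), if_neg (by omega)]
  rfl

theorem swap_self_left (i : ℕ) : Equiv.swap i (i + 1) i = i + 1 := Equiv.swap_apply_left ..

theorem swap_self_right (i : ℕ) : Equiv.swap i (i + 1) (i + 1) = i := Equiv.swap_apply_right ..

theorem swap_gt {i k : ℕ} (h : i + 1 < k) : Equiv.swap i (i + 1) k = k :=
  Equiv.swap_apply_of_ne_of_ne (by omega) (by omega)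

theorem swap_lt {i k : ℕ} (h : k < i) : Equiv.swap i (i + 1) k = k :=
  Equiv.swap_apply_of_ne_of_ne (by omega) (by omega)

theorem sg_comm_xl {M i j : ℕ} (hi : i < M) (h1 : j ≠ i) (h2 : j ≠ i + 1) :
    (inr (sg M i) : Sd M) * inl (xl M j) = inl (xl M j) * inr (sg M i) := by
  rw [inr_mul_inl, art_sg_xl hi, if_neg h1, if_neg h2]

theorem av_comm {M i j : ℕ} (h : i + 2 ≤ j) (hj : j < M + 1) (k : ℕ) :
    av M i k * av M j (Equiv.swap i (i + 1) k) = av M j k * av M i (Equiv.swap j (j + 1) k) := by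
  obtain ⟨j, rfl⟩ : ∃ j', j = j' + 1 := ⟨j - 1, by omega⟩
  have hij : i < j := by omega
  by_cases h1 : k = i
  · subst h1
    rw [swap_self_left, av_self, av_lt (by omega), av_lt (by omega), swap_lt (by omega), av_self,
      sg_comm_xl (by omega) (by omega) (by omega)]
  by_cases h2 : k = i + 1
  · subst h2
    rw [swap_self_right, av_succ, av_lt (by omega), av_lt (by omega), swap_lt (by omega), av_succ,
      one_mul, mul_one]
  by_cases h3 : k = j + 1
  · subst h3
    rw [swap_self_left, swap_gt (by omega), av_gt (by omega) (by omega), av_self,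
      av_gt (by omega) (by omega), sg_comm_xl (by omega) (by omega) (by omega)]
  by_cases h4 : k = j + 1 + 1
  · subst h4
    rw [swap_self_right, swap_gt (by omega), av_gt (by omega) (by omega), av_succ,
      av_gt (by omega) (by omega), one_mul, mul_one]
  rcases Nat.lt_or_ge k i with h5 | h5
  · obtain ⟨i, rfl⟩ : ∃ i', i = i' + 1 := ⟨i - 1, by omega⟩
    rw [swap_lt h5, swap_lt (by omega), av_lt (by omega), av_lt (by omega), ← map_mul, ← map_mul,
      (sg_comm (by omega : i + 2 ≤ j)).eq]
  rcases Nat.lt_or_ge k (j + 1) with h6 | h6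
  · rw [swap_gt (by omega), swap_lt (by omega), av_lt (by omega), av_gt (by omega) (by omega),
      ← map_mul, ← map_mul, (sg_comm (by omega : i + 2 ≤ j)).eq]
  rw [swap_gt (by omega), swap_gt (by omega)]
  by_cases h7 : k ≤ M + 1
  · rw [av_gt (by omega) h7, av_gt (by omega) h7, ← map_mul, ← map_mul,
      (sg_comm (by omega : i + 2 ≤ j + 1)).eq]
  · rw [av_out (by omega) (by omega), av_out (by omega) (by omega)]

theorem av_braid {M i : ℕ} (h : i + 1 < M + 1) (k : ℕ) :
    av M i k * av M (i + 1) (Equiv.swap i (i + 1) k) *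
        av M i (Equiv.swap (i + 1) (i + 1 + 1) (Equiv.swap i (i + 1) k)) =
      av M (i + 1) k * av M i (Equiv.swap (i + 1) (i + 1 + 1) k) *
        av M (i + 1) (Equiv.swap i (i + 1) (Equiv.swap (i + 1) (i + 1 + 1) k)) := by
  have hiM : i < M := by omega
  by_cases h1 : k = i
  · subst h1
    rw [swap_self_left, swap_self_left, swap_lt (by omega), swap_self_left, av_self, av_self,
      av_gt (by omega) (by omega), av_lt le_rfl, inr_mul_inl, mul_assoc (inl _) (inr _),
      inr_mul_inl, ← mul_assoc, ← map_mul, ← map_mul, art_sg_xl hiM, art_sg_xl hiM, if_pos rfl,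
      if_neg (by omega), if_pos rfl, mul_assoc _⁻¹, mul_inv_cancel_left]
  by_cases h2 : k = i + 1
  · subst h2
    rw [swap_self_right, swap_lt (by omega), swap_self_left, swap_gt (by omega), av_succ M i,
      av_self M i, av_self M (i + 1), av_gt (i := i) (by omega) (by omega),
      av_lt (i := i) (k := i) le_rfl, av_succ, one_mul, mul_one, inr_mul_inl, art_sg_xl hiM,
      if_pos rfl]
  by_cases h3 : k = i + 1 + 1
  · subst h3
    rw [swap_gt (by omega), swap_self_right, swap_self_right, av_gt (by omega) (by omega), av_succ,
      av_succ, av_lt (by omega), one_mul, mul_one, mul_one, one_mul]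
  rcases Nat.lt_or_ge k i with h5 | h5
  · obtain ⟨i, rfl⟩ : ∃ i', i = i' + 1 := ⟨i - 1, by omega⟩
    rw [swap_lt h5, swap_lt (by omega), swap_lt h5, av_lt (by omega), av_lt (by omega), ← map_mul,
      ← map_mul, ← map_mul, ← map_mul, sg_braid (by omega)]
  · rw [swap_gt (by omega), swap_gt (by omega), swap_gt (by omega)]
    by_cases h7 : k ≤ M + 1
    · rw [av_gt (by omega) h7, av_gt (by omega) h7, ← map_mul, ← map_mul, ← map_mul, ← map_mul,
        sg_braid (by omega)]
    · rw [av_out (by omega) (by omega), av_out (by omega) (by omega)]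

/-- Right multiplication by a generator on cosets of the stabilizer of the last strand. -/
def ae (M i : ℕ) : Equiv.Perm (Sd M × ℕ) where
  toFun p := (p.1 * av M i p.2, Equiv.swap i (i + 1) p.2)
  invFun p := (p.1 * (av M i (Equiv.swap i (i + 1) p.2))⁻¹, Equiv.swap i (i + 1) p.2)
  left_inv p := by simp
  right_inv p := by simp

/-- The right action of the braid group on the cosets of the stabilizer of the last strand. -/
def actHom (M : ℕ) : Bd (M + 1) →* (Equiv.Perm (Sd M × ℕ))ᵐᵒᵖ :=
  bdLift (M + 1) (fun i => MulOpposite.op (ae M i))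
    (fun i j h hj => by
      rw [← MulOpposite.op_mul, ← MulOpposite.op_mul]
      congr 1
      refine Equiv.ext fun p => Prod.ext ?_ ?_
      · simp only [Equiv.Perm.mul_apply, ae, Equiv.coe_fn_mk, mul_assoc]
        rw [av_comm h hj]
      · simp only [Equiv.Perm.mul_apply, ae, Equiv.coe_fn_mk]
        simp only [Equiv.swap_apply_def]
        grind)
    (fun i h => by
      rw [← MulOpposite.op_mul, ← MulOpposite.op_mul, ← MulOpposite.op_mul, ← MulOpposite.op_mul]
      congr 1
      refine Equiv.ext fun p => Prod.ext ?_ ?_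
      · have := av_braid h p.2
        simp only [mul_assoc] at this
        simp only [Equiv.Perm.mul_apply, ae, Equiv.coe_fn_mk, mul_assoc]
        rw [this]
      · simp only [Equiv.Perm.mul_apply, ae, Equiv.coe_fn_mk]
        simp only [Equiv.swap_apply_def]
        grind)

/-- The right action of a braid on a coset. -/
def act {M : ℕ} (b : Bd (M + 1)) (p : Sd M × ℕ) : Sd M × ℕ := (actHom M b).unop p

theorem act_one {M : ℕ} (p : Sd M × ℕ) : act 1 p = p := by simp [act]

theorem act_mul {M : ℕ} (a b : Bd (M + 1)) (p : Sd M × ℕ) : act (a * b) p = act b (act a p) := by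
  simp [act]

theorem act_sg {M i : ℕ} (hi : i < M + 1) (g : Sd M) (k : ℕ) :
    act (sg (M + 1) i) (g, k) = (g * av M i k, Equiv.swap i (i + 1) k) := by
  rw [act, actHom, bdLift_sg _ _ hi]
  rfl

theorem act_act_inv {M : ℕ} (a : Bd (M + 1)) (p : Sd M × ℕ) : act a (act a⁻¹ p) = p := by
  rw [← act_mul, inv_mul_cancel, act_one]

theorem act_inv_eq {M : ℕ} {a : Bd (M + 1)} {p q : Sd M × ℕ} (h : act a p = q) :
    act a⁻¹ q = p := by
  rw [← h, ← act_mul, mul_inv_cancel, act_one]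

theorem act_left {M : ℕ} (b : Bd (M + 1)) :
    ∀ (u : Sd M) (p : Sd M × ℕ), act b (u * p.1, p.2) = (u * (act b p).1, (act b p).2) := by
  induction b using bd_induction with
  | one => intro u p; simp [act_one]
  | mul a b ha hb => intro u p; rw [act_mul, ha, hb, act_mul]
  | inv a ha =>
    intro u p
    apply act_inv_eq
    rw [ha, act_act_inv]
  | gen i hi => rintro u ⟨g, k⟩; rw [act_sg hi, act_sg hi, mul_assoc]

theorem act_snd {M : ℕ} (b : Bd (M + 1)) :
    ∀ p : Sd M × ℕ, perm (M + 1) b (act b p).2 = p.2 := by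
  induction b using bd_induction with
  | one => intro p; simp [act_one]
  | mul a b ha hb => intro p; rw [act_mul, map_mul, Equiv.Perm.mul_apply, hb, ha]
  | inv a ha =>
    intro p
    have := ha (act a⁻¹ p)
    rw [act_act_inv] at this
    rw [map_inv, Equiv.Perm.inv_eq_iff_eq, this]
  | gen i hi => rintro ⟨g, k⟩; rw [act_sg hi, perm_sg hi, Equiv.swap_apply_self]

theorem act_snd_le {M : ℕ} (b : Bd (M + 1)) {p : Sd M × ℕ} (hp : p.2 ≤ M + 1) :
    (act b p).2 ≤ M + 1 := by
  by_contra h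
  have h1 := perm_fix_of_lt b _ (not_le.1 h)
  rw [act_snd] at h1
  omega

/-- The braid attached to a coset. -/
def psi {M : ℕ} (p : Sd M × ℕ) : Bd (M + 1) := iota M p.1 * tl M p.2

theorem psi_act {M : ℕ} (b : Bd (M + 1)) :
    ∀ p : Sd M × ℕ, p.2 ≤ M + 1 → psi (act b p) = psi p * b := by
  induction b using bd_induction with
  | one => intro p _; simp [act_one]
  | mul a b ha hb =>
    intro p hp
    rw [act_mul, hb _ (act_snd_le a hp), ha p hp, mul_assoc]
  | inv a ha =>
    intro p hp
    rw [eq_mul_inv_iff_mul_eq, ← ha _ (act_snd_le _ hp), act_act_inv]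
  | gen i hi =>
    rintro ⟨g, k⟩ hk
    simp only at hk
    rw [act_sg hi, psi, psi, map_mul, mul_assoc, mul_assoc]
    congr 1
    by_cases h1 : k = i
    · subst h1
      rw [av_self, iota_inl, fibre_xl (by omega), swap_self_left, tl_succ (by omega : k ≤ M), pg]
      group
    by_cases h2 : k = i + 1
    · subst h2
      rw [av_succ, map_one, one_mul, swap_self_right, tl_succ (by omega : i ≤ M)]
    rcases Nat.lt_or_ge k i with h3 | h3
    · obtain ⟨i, rfl⟩ : ∃ i', i = i' + 1 := ⟨i - 1, by omega⟩
      rw [swap_lt h3, av_lt (by omega), iota_inr, incl_sg (by omega),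
        tl_shift (by omega) (by omega)]
    · rw [swap_gt (by omega), av_gt (by omega) hk, iota_inr, incl_sg (by omega),
        (tl_comm (by omega) (by omega)).eq]

theorem act_tl {M : ℕ} (g : Sd M) {k : ℕ} (hk : k ≤ M + 1) : act (tl M k) (g, M + 1) = (g, k) := by
  refine down_induction (p := fun k => act (tl M k) (g, M + 1) = (g, k)) ?_ ?_ k hk
  · rw [tl_top, act_one]
  · intro k hk ih
    rw [tl_succ (by omega), act_mul, ih, act_sg (by omega), av_succ, mul_one, swap_self_right]

theorem act_pg {M : ℕ} (g : Sd M) {i : ℕ} (hi : i ≤ M) :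
    act (pg M i) (g, M + 1) = (g * inl (xl M i), M + 1) := by
  rw [pg, act_mul, act_mul, act_mul, act_tl g (by omega), act_sg (by omega), act_sg (by omega),
    av_succ, swap_self_right, av_self, swap_self_left, mul_one]
  exact act_inv_eq (act_tl _ (by omega))

theorem act_iota {M : ℕ} (v g : Sd M) : act (iota M v) (g, M + 1) = (g * v, M + 1) := by
  let H : Subgroup (Sd M) :=
    { carrier := {v | ∀ g, act (iota M v) (g, M + 1) = (g * v, M + 1)}
      one_mem' := fun g => by rw [map_one, act_one, mul_one]
      mul_mem' := fun {a b} ha hb g => by rw [map_mul, act_mul, ha, hb, mul_assoc]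
      inv_mem' := fun {a} ha g => by
        rw [map_inv]
        apply act_inv_eq
        rw [ha, inv_mul_cancel_right] }
  have h1 : ∀ f, inl f ∈ H := fun f => by
    induction f using FreeGroup.induction_on with
    | C1 => rw [map_one]; exact H.one_mem
    | of i =>
      rw [of_eq_xl]
      intro g
      rw [iota_inl, fibre_xl (by omega), act_pg g (by omega)]
    | inv_of i h => rw [map_inv]; exact H.inv_mem h
    | mul a b ha hb => rw [map_mul]; exact H.mul_mem ha hb
  have h2 : ∀ b, inr b ∈ H := fun b => by
    induction b using bd_induction with
    | one => rw [map_one]; exact H.one_mem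
    | mul a b ha hb => rw [map_mul]; exact H.mul_mem ha hb
    | inv a ha => rw [map_inv]; exact H.inv_mem ha
    | gen i hi =>
      intro g
      rw [iota_inr, incl_sg hi, act_sg (by omega), av_gt (by omega) le_rfl, swap_gt (by omega)]
  have h3 : v ∈ H := by
    rw [← inl_left_mul_inr_right v]
    exact H.mul_mem (h1 _) (h2 _)
  exact h3 g

theorem iota_injective (M : ℕ) : Function.Injective (iota M) := fun u v h => by
  have h1 := act_iota u 1
  rw [h, act_iota, one_mul, one_mul] at h1
  exact (congrArg Prod.fst h1).symm

theorem exists_eq_iota_mul_tl {M : ℕ} (b : Bd (M + 1)) :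
    ∃ u k, k ≤ M + 1 ∧ b = iota M u * tl M k := by
  have h := psi_act b (1, M + 1) le_rfl
  refine ⟨(act b (1, M + 1)).1, (act b (1, M + 1)).2, act_snd_le b le_rfl, ?_⟩
  have h1 : psi ((1, M + 1) : Sd M × ℕ) = 1 := by rw [psi, map_one, tl_top, one_mul]
  rw [h1, one_mul] at h
  exact h.symm

theorem eq_iota_of_perm {M : ℕ} {b : Bd (M + 1)} (h : perm (M + 1) b (M + 1) = M + 1) :
    ∃ u, b = iota M u := by
  have h2 := act_snd b (1, M + 1)
  have h3 : (act b (1, M + 1)).2 = M + 1 := by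
    apply (perm (M + 1) b).injective
    rw [h2, h]
  have h := psi_act b (1, M + 1) le_rfl
  have h1 : psi ((1, M + 1) : Sd M × ℕ) = 1 := by rw [psi, map_one, tl_top, one_mul]
  rw [h1, one_mul, psi, h3, tl_top, mul_one] at h
  exact ⟨_, h.symm⟩

theorem braidGroup_comm {n : ℕ} {i j : Fin (n - 1)}
    (h : (i : ℕ) + 2 ≤ (j : ℕ) ∨ (j : ℕ) + 2 ≤ (i : ℕ)) :
    Commute (PresentedGroup.of i : BraidGroup n) (PresentedGroup.of j) := by
  rcases n with _ | n
  · exact i.elim0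
  · have hi : (PresentedGroup.of i : Bd n) = sg n i := (sg_of_lt i.2).symm
    have hj : (PresentedGroup.of j : Bd n) = sg n j := (sg_of_lt j.2).symm
    rw [hi, hj]
    exact h.elim sg_comm fun h => (sg_comm h).symm

theorem braidGroup_braid {n : ℕ} {i j : Fin (n - 1)}
    (h : (i : ℕ) + 1 = (j : ℕ) ∨ (j : ℕ) + 1 = (i : ℕ)) :
    (PresentedGroup.of i : BraidGroup n) * PresentedGroup.of j * PresentedGroup.of i =
      PresentedGroup.of j * PresentedGroup.of i * PresentedGroup.of j := by
  rcases n with _ | n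
  · exact i.elim0
  · have hi : (PresentedGroup.of i : Bd n) = sg n i := (sg_of_lt i.2).symm
    have hj : (PresentedGroup.of j : Bd n) = sg n j := (sg_of_lt j.2).symm
    rw [hi, hj]
    rcases h with h | h
    · rw [← h]; exact sg_braid (h ▸ j.2)
    · rw [← h]; exact (sg_braid (h ▸ i.2)).symm

/-- The desingularization of a letter. -/
noncomputable def desingLetter (n : ℕ) : SGen n → MonoidAlgebra ℤ (BraidGroup n)
  | .pos i => MonoidAlgebra.of ℤ (BraidGroup n) (PresentedGroup.of i)
  | .neg i => MonoidAlgebra.of ℤ (BraidGroup n) (PresentedGroup.of i)⁻¹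
  | .sing i => MonoidAlgebra.of ℤ (BraidGroup n) (PresentedGroup.of i) -
      MonoidAlgebra.of ℤ (BraidGroup n) (PresentedGroup.of i)⁻¹

theorem desingLetter_rel {n : ℕ} {u v : FreeMonoid (SGen n)} (h : SBRel n u v) :
    FreeMonoid.lift (desingLetter n) u = FreeMonoid.lift (desingLetter n) v := by
  induction h <;> simp only [sw, map_mul, map_one, FreeMonoid.lift_eval_of, desingLetter] <;>
    simp only [mul_sub, sub_mul, ← map_mul]
  case posNeg i => rw [mul_inv_cancel, map_one]
  case negPos i => rw [inv_mul_cancel, map_one]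
  case posSing i => rw [mul_inv_cancel, inv_mul_cancel]
  case commPosPos i j h => rw [(braidGroup_comm h).eq]
  case commPosSing i j h =>
    rw [(braidGroup_comm h).eq, (braidGroup_comm h).inv_right.eq]
  case commSingSing i j h =>
    rw [(braidGroup_comm h).eq, (braidGroup_comm h).inv_right.eq, (braidGroup_comm h).inv_left.eq,
      (braidGroup_comm h).inv_left.inv_right.eq]
    abel
  case braidPos i j h => rw [braidGroup_braid h]
  case braidSing i j h =>
    have := braidGroup_braid h
    rw [this]
    congr 2
    rw [mul_inv_eq_iff_eq_mul]
    calc _ = (PresentedGroup.of j : BraidGroup n)⁻¹ *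
        (PresentedGroup.of j * PresentedGroup.of i * PresentedGroup.of j) := by group
      _ = _ := by rw [← this]; group

/-- The desingularization map. -/
noncomputable def desing (n : ℕ) : SBMonoid n →* MonoidAlgebra ℤ (BraidGroup n) :=
  (conGen (SBRel n)).lift (FreeMonoid.lift (desingLetter n))
    (Con.conGen_le.2 fun _ _ h => desingLetter_rel h)

theorem desing_sGen {n : ℕ} (g : SGen n) : desing n (sGen n g) = desingLetter n g := by
  rw [desing, sGen, Con.lift_mk', sw, FreeMonoid.lift_eval_of]

theorem closure_sGen (n : ℕ) : Submonoid.closure (Set.range (sGen n)) = ⊤ := by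
  have h := FreeMonoid.closure_range_of (α := SGen n)
  have h2 := congrArg (Submonoid.map (conGen (SBRel n)).mk') h
  rw [MonoidHom.map_mclosure, ← Set.range_comp, ← MonoidHom.mrange_eq_map,
    MonoidHom.mrange_eq_top.2 Con.mk'_surjective] at h2
  exact h2

theorem sGen_rel {n : ℕ} {u v : FreeMonoid (SGen n)} (h : SBRel n u v) :
    (conGen (SBRel n)).mk' u = (conGen (SBRel n)).mk' v :=
  (Con.eq _).2 (ConGen.Rel.of _ _ h)

/-- The `i`-th invertible generator of the singular braid monoid (trivial if out of range). -/
def su (N i : ℕ) : (SBMonoid (N + 1))ˣ :=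
  if h : i < N then
    { val := sGen (N + 1) (.pos (⟨i, h⟩ : Fin N))
      inv := sGen (N + 1) (.neg (⟨i, h⟩ : Fin N))
      val_inv := sGen_rel (.posNeg (n := N + 1) (⟨i, h⟩ : Fin N))
      inv_val := sGen_rel (.negPos (n := N + 1) (⟨i, h⟩ : Fin N)) }
  else 1

/-- The `i`-th singular generator of the singular braid monoid (trivial if out of range). -/
def ts (N i : ℕ) : SBMonoid (N + 1) :=
  if h : i < N then sGen (N + 1) (.sing (⟨i, h⟩ : Fin N)) else 1

theorem su_of_lt {N i : ℕ} (h : i < N) : (su N i : SBMonoid (N + 1)) =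
    sGen (N + 1) (.pos (⟨i, h⟩ : Fin N)) := by rw [su, dif_pos h]

theorem ts_of_lt {N i : ℕ} (h : i < N) :
    ts N i = sGen (N + 1) (.sing (⟨i, h⟩ : Fin N)) := dif_pos h

/-- The units of the singular braid monoid given by braids. -/
def jUnits (N : ℕ) : Bd N →* (SBMonoid (N + 1))ˣ :=
  bdLift N (su N)
    (fun i j h hj => Units.ext (by
      rw [Units.val_mul, Units.val_mul, su_of_lt hj, su_of_lt (by omega)]
      exact sGen_rel (.commPosPos (n := N + 1) (⟨i, by omega⟩ : Fin N) (⟨j, hj⟩ : Fin N) (.inl h))))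
    (fun i hi => Units.ext (by
      simp only [Units.val_mul]
      rw [su_of_lt hi, su_of_lt (by omega)]
      exact sGen_rel (.braidPos (n := N + 1) (⟨i, by omega⟩ : Fin N) (⟨i + 1, hi⟩ : Fin N)
        (.inl rfl))))

/-- The homomorphism from braids to singular braids. -/
def jj (N : ℕ) : Bd N →* SBMonoid (N + 1) := (Units.coeHom _).comp (jUnits N)

theorem jj_sg {N i : ℕ} (hi : i < N) :
    jj N (sg N i) = sGen (N + 1) (.pos (⟨i, hi⟩ : Fin N)) := by
  rw [jj, MonoidHom.comp_apply, jUnits, bdLift_sg _ _ hi, ← su_of_lt hi]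
  rfl

theorem jj_mul_inv {N : ℕ} (b : Bd N) : jj N b * jj N b⁻¹ = 1 := by
  rw [← map_mul, mul_inv_cancel, map_one]

theorem jj_inv_mul {N : ℕ} (b : Bd N) : jj N b⁻¹ * jj N b = 1 := by
  rw [← map_mul, inv_mul_cancel, map_one]

theorem sg_ts_self (N i : ℕ) : Commute (jj N (sg N i)) (ts N i) := by
  by_cases hi : i < N
  · rw [jj_sg hi, ts_of_lt hi]
    exact sGen_rel (.posSing (n := N + 1) (⟨i, hi⟩ : Fin N))
  · rw [ts, dif_neg hi]
    exact Commute.one_right _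

theorem sg_ts_comm {N i j : ℕ} (h : i + 2 ≤ j ∨ j + 2 ≤ i) :
    Commute (jj N (sg N i)) (ts N j) := by
  by_cases hj : j < N
  · by_cases hi : i < N
    · rw [jj_sg hi, ts_of_lt hj]
      exact sGen_rel (.commPosSing (n := N + 1) (⟨i, hi⟩ : Fin N) (⟨j, hj⟩ : Fin N) h)
    · rw [sg, dif_neg hi, map_one]
      exact Commute.one_left _
  · rw [ts, dif_neg hj]
    exact Commute.one_right _

theorem ts_ts_comm {N i j : ℕ} (h : i + 2 ≤ j) : Commute (ts N i) (ts N j) := by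
  by_cases hj : j < N
  · rw [ts_of_lt (by omega : i < N), ts_of_lt hj]
    exact sGen_rel (.commSingSing (n := N + 1) (⟨i, by omega⟩ : Fin N) (⟨j, hj⟩ : Fin N) (.inl h))
  · rw [ts, ts, dif_neg hj]
    exact Commute.one_right _

theorem sg_ts_braid {N i j : ℕ} (hi : i < N) (hj : j < N) (h : i + 1 = j ∨ j + 1 = i) :
    jj N (sg N i * sg N j) * ts N i = ts N j * jj N (sg N i * sg N j) := by
  rw [map_mul, jj_sg hi, jj_sg hj, ts_of_lt hi, ts_of_lt hj, ← mul_assoc]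
  exact sGen_rel (.braidSing (n := N + 1) (⟨i, hi⟩ : Fin N) (⟨j, hj⟩ : Fin N) h)

theorem tl_ts_shift {M k : ℕ} (hk : k ≤ M) :
    jj (M + 1 + 1) (tl (M + 1) k) * ts (M + 1 + 1) (M + 1) =
      ts (M + 1 + 1) M * jj (M + 1 + 1) (tl (M + 1) k) := by
  refine down_induction (M := M) (p := fun k => jj (M + 1 + 1) (tl (M + 1) k) *
    ts (M + 1 + 1) (M + 1) = ts (M + 1 + 1) M * jj (M + 1 + 1) (tl (M + 1) k)) ?_ ?_ k hk
  · rw [tl_succ (by omega : M ≤ M + 1), tl_succ le_rfl, tl_top, one_mul]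
    exact sg_ts_braid (by omega) (by omega) (.inr rfl)
  · intro k hk ih
    rw [tl_succ (by omega), map_mul, mul_assoc, (sg_ts_comm (by omega)).eq, ← mul_assoc, ih,
      mul_assoc]

theorem desing_jj {N : ℕ} (b : Bd N) :
    desing (N + 1) (jj N b) = MonoidAlgebra.of ℤ (BraidGroup (N + 1)) b := by
  refine mem_of_gen (H := MonoidHom.eqLocus ((desing (N + 1)).comp (jj N))
    (MonoidAlgebra.of ℤ (BraidGroup (N + 1)))) (fun i hi => ?_) b
  change desing (N + 1) (jj N (sg N i)) = _
  rw [jj_sg hi, desing_sGen, sg_of_lt hi]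
  rfl

theorem desing_ts {N i : ℕ} (hi : i < N) : desing (N + 1) (ts N i * jj N (sg N i)) =
    MonoidAlgebra.of ℤ (BraidGroup (N + 1)) (sg N i * sg N i) - 1 := by
  rw [map_mul, desing_jj, ts_of_lt hi, desing_sGen, map_mul]
  change (MonoidAlgebra.of ℤ (BraidGroup (N + 1)) _ - MonoidAlgebra.of ℤ (BraidGroup (N + 1)) _) *
    _ = _
  rw [← sg_of_lt hi, sub_mul, ← map_mul, ← map_mul, inv_mul_cancel, map_one]

theorem closure_jj_ts (N : ℕ) : Submonoid.closure (Set.range (jj (N + 1)) ∪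
    Set.range fun _ : Unit => ts (N + 1) N * jj (N + 1) (sg (N + 1) N)) = ⊤ := by
  set K := Submonoid.closure (Set.range (jj (N + 1)) ∪
    Set.range fun _ : Unit => ts (N + 1) N * jj (N + 1) (sg (N + 1) N)) with hK
  have h1 : ∀ b, jj (N + 1) b ∈ K := fun b => Submonoid.subset_closure (.inl ⟨b, rfl⟩)
  have h2 : ∀ i ≤ N, ts (N + 1) i ∈ K := by
    refine down_induction ?_ ?_
    · have h3 : ts (N + 1) N * jj (N + 1) (sg (N + 1) N) ∈ K :=
        Submonoid.subset_closure (.inr ⟨(), rfl⟩)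
      have h4 := K.mul_mem h3 (h1 (sg (N + 1) N)⁻¹)
      rwa [mul_assoc, jj_mul_inv, mul_one] at h4
    · intro k hk h
      have h3 := sg_ts_braid (N := N + 1) (i := k) (j := k + 1) (by omega) (by omega) (.inl rfl)
      have h4 : ts (N + 1) k = jj (N + 1) (sg (N + 1) k * sg (N + 1) (k + 1))⁻¹ *
          (ts (N + 1) (k + 1) * jj (N + 1) (sg (N + 1) k * sg (N + 1) (k + 1))) := by
        rw [← h3, ← mul_assoc, jj_inv_mul, one_mul]
      rw [h4]
      exact K.mul_mem (h1 _) (K.mul_mem h (h1 _))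
  rw [eq_top_iff, ← closure_sGen, Submonoid.closure_le]
  rintro _ ⟨i | i | i, rfl⟩
  · have := h1 (sg (N + 1) i)
    rwa [jj_sg (N := N + 1) i.2] at this
  · have h3 := h1 (sg (N + 1) i)⁻¹
    have h4 : jj (N + 1) (sg (N + 1) i)⁻¹ = sGen (N + 1 + 1) (.neg i) := by
      have h5 := sGen_rel (.negPos (n := N + 1 + 1) i)
      rw [map_mul] at h5
      change sGen (N + 1 + 1) (.neg i) * sGen (N + 1 + 1) (.pos i) = _ at h5
      have h6 := jj_sg (N := N + 1) i.2
      calc _ = 1 * jj (N + 1) (sg (N + 1) i)⁻¹ := (one_mul _).symm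
        _ = _ := by
          rw [← map_one (conGen (SBRel (N + 1 + 1))).mk', ← h5, mul_assoc]
          conv_lhs => rw [show sGen (N + 1 + 1) (SGen.pos i) = _ from h6.symm]
          rw [jj_mul_inv, mul_one]
    rwa [h4] at h3
  · have := h2 i (Nat.lt_succ_iff.1 i.2)
    rwa [ts_of_lt (N := N + 1) i.2] at this

/-- The exponent sum of the letter `q`. -/
def expo (M q : ℕ) : FreeGroup (Fin (M + 1)) →* Multiplicative ℤ :=
  FreeGroup.lift fun i => Multiplicative.ofAdd (if (i : ℕ) = q then (1 : ℤ) else 0)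

theorem expo_xl {M i : ℕ} (q : ℕ) (hi : i ≤ M) :
    expo M q (xl M i) = Multiplicative.ofAdd (if i = q then (1 : ℤ) else 0) := by
  rw [xl_of_lt (by omega), expo, FreeGroup.lift_apply_of]

theorem expo_conj {M q : ℕ} (h f : FreeGroup (Fin (M + 1))) :
    expo M q (h * f * h⁻¹) = expo M q f := by
  rw [map_mul, map_mul, map_inv, mul_comm, inv_mul_cancel_left]

theorem eq_of_conj_xl_zpow {M p q : ℕ} (hp : p ≤ M) (hq : q ≤ M) {m m' : ℤ} (hm : m ≠ 0)
    {h : FreeGroup (Fin (M + 1))} (e : h * xl M p ^ m * h⁻¹ = xl M q ^ m') : p = q := by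
  by_contra hpq
  have := congrArg (expo M p) e
  rw [expo_conj, map_zpow, map_zpow, expo_xl _ hp, expo_xl _ hq, if_pos rfl,
    if_neg (Ne.symm hpq), ofAdd_zero, one_zpow, ← ofAdd_zsmul, ← ofAdd_zero,
    Multiplicative.ofAdd.injective.eq_iff] at this
  simp at this
  exact hm this

/-- The square of an Artin generator. -/
def sq (N i : ℕ) : Bd N := sg N i * sg N i

theorem iota_xl {M i : ℕ} (hi : i ≤ M) : iota M (inl (xl M i)) = pg M i := by
  rw [iota_inl, fibre_xl hi]

theorem iota_last (M : ℕ) : iota M (inl (xl M M)) = sq (M + 1) M := by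
  rw [iota_xl le_rfl, pg_last, sq]

theorem sq_zpow_ne_one {N i : ℕ} (hi : i < N) {m : ℤ} (hm : m ≠ 0) : sq N i ^ m ≠ 1 := by
  rw [sq, ← zpow_two, ← zpow_mul]
  exact sg_zpow_ne_one hi (by omega)

/-- The braids commuting with a generator and with the corresponding singular generator. -/
def cent (N i : ℕ) : Subgroup (Bd N) where
  carrier := {b | Commute b (sg N i) ∧ Commute (jj N b) (ts N i)}
  one_mem' := ⟨Commute.one_left _, by rw [map_one]; exact Commute.one_left _⟩
  mul_mem' := fun ha hb => ⟨ha.1.mul_left hb.1, by rw [map_mul]; exact ha.2.mul_left hb.2⟩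
  inv_mem' := fun {a} ha => ⟨ha.1.inv_left, by
    have h := ha.2.eq
    calc jj N a⁻¹ * ts N i = jj N a⁻¹ * ts N i * (jj N a * jj N a⁻¹) := by
          rw [jj_mul_inv, mul_one]
      _ = jj N a⁻¹ * (ts N i * jj N a) * jj N a⁻¹ := by simp only [mul_assoc]
      _ = _ := by rw [← h, ← mul_assoc, jj_inv_mul, one_mul]⟩

theorem sg_mem_cent (N i : ℕ) : sg N i ∈ cent N i := ⟨Commute.refl _, sg_ts_self N i⟩

theorem sg_mem_cent_of_far {N i j : ℕ} (h : i + 2 ≤ j) : sg N i ∈ cent N j :=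
  ⟨sg_comm h, sg_ts_comm (.inl h)⟩

theorem commute_sq_of_mem_cent {N i : ℕ} {b : Bd N} (h : b ∈ cent N i) : Commute b (sq N i) :=
  h.1.mul_right h.1

theorem full_loop_mem_cent (M : ℕ) :
    sg (M + 2) M * (sg (M + 2) (M + 1) * sg (M + 2) (M + 1)) * sg (M + 2) M ∈
      cent (M + 2) (M + 1) := by
  have h1 := sg_braid (N := M + 2) (i := M) (by omega)
  have h2 := sg_ts_braid (N := M + 2) (i := M) (j := M + 1) (by omega) (by omega) (.inl rfl)
  have h3 := sg_ts_braid (N := M + 2) (i := M + 1) (j := M) (by omega) (by omega) (.inr rfl)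
  generalize sg (M + 2) M = a at *
  constructor
  · generalize sg (M + 2) (M + 1) = b at *
    change a * (b * b) * a * b = b * (a * (b * b) * a)
    calc a * (b * b) * a * b = a * b * (b * a * b) := by simp only [mul_assoc]
      _ = a * b * a * b * a := by rw [← h1]; simp only [mul_assoc]
      _ = _ := by rw [h1]; simp only [mul_assoc]
  · rw [show a * (sg (M + 2) (M + 1) * sg (M + 2) (M + 1)) * a =
      (a * sg (M + 2) (M + 1)) * (sg (M + 2) (M + 1) * a) by simp only [mul_assoc],
      map_mul, commute_iff_eq, mul_assoc, h3, ← mul_assoc, h2, mul_assoc]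

theorem exists_lift_mem_cent {M : ℕ} (β : Bd M) (h : perm M β M = M) :
    ∃ u : Sd M, u.right = β ∧ iota M u ∈ cent (M + 1) M := by
  rcases M with _ | M
  · have : β = 1 := by
      induction β using bd_induction with
      | one => rfl
      | mul a b ha hb =>
        have h0 : ∀ b : Bd 0, perm 0 b 0 = 0 := fun b => Nat.le_zero.1 (perm_le b le_rfl)
        rw [ha (h0 a), hb (h0 b), one_mul]
      | inv a ha =>
        have h0 : ∀ b : Bd 0, perm 0 b 0 = 0 := fun b => Nat.le_zero.1 (perm_le b le_rfl)
        rw [ha (h0 a), inv_one]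
      | gen i hi => omega
    exact ⟨1, by rw [this]; rfl, by rw [map_one]; exact Subgroup.one_mem _⟩
  obtain ⟨u, rfl⟩ := eq_iota_of_perm h
  let H : Subgroup (Bd (M + 1)) :=
    ((cent (M + 1 + 1) (M + 1)).comap (iota (M + 1))).map rightHom
  have h1 : ∀ i < M, sg (M + 1) i ∈ H := fun i hi =>
    ⟨inr (sg (M + 1) i), by
      rw [SetLike.mem_coe, Subgroup.mem_comap, iota_inr, incl_sg (by omega)]
      exact sg_mem_cent_of_far (by omega), rightHom_inr _⟩
  have h2 : ∀ q ≤ M, pg M q ∈ H := by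
    refine down_induction ?_ ?_
    · refine ⟨inr (sg (M + 1) M * sg (M + 1) M) * inl (xl (M + 1) M), ?_, ?_⟩
      · rw [SetLike.mem_coe, Subgroup.mem_comap]
        have h3 := full_loop_mem_cent M
        have h4 := braid_sq (sg_braid (N := M + 2) (i := M) (by omega))
        rw [map_mul, iota_inr, map_mul, incl_sg (by omega), iota_xl (by omega), pg,
          tl_succ le_rfl, tl_top, one_mul]
        generalize sg (M + 2) M = a at *
        generalize sg (M + 2) (M + 1) = b at *
        have h5 : b * (a * a) * b⁻¹ = a⁻¹ * (b * b) * a := by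
          rw [mul_inv_eq_iff_eq_mul, mul_assoc a⁻¹, mul_assoc a⁻¹, eq_inv_mul_iff_mul_eq,
            ← mul_assoc, h4]
          simp only [mul_assoc]
        rw [h5]
        convert h3 using 1
        group
      · rw [map_mul, rightHom_inr, rightHom_inl, mul_one, pg_last]
    · intro q hq h3
      have h4 : pg M q = (sg (M + 1) q)⁻¹ * pg M (q + 1) * sg (M + 1) q := by
        rw [mul_assoc, ← sg_pg hq, inv_mul_cancel_left]
      rw [h4]
      exact H.mul_mem (H.mul_mem (H.inv_mem (h1 q hq)) h3) (h1 q hq)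
  have h3 : ∀ f, iota M (inl f) ∈ H := fun f => by
    induction f using FreeGroup.induction_on with
    | C1 => rw [map_one, map_one]; exact H.one_mem
    | of i => rw [of_eq_xl, iota_xl (by omega)]; exact h2 i (by omega)
    | inv_of i h => rw [map_inv, map_inv]; exact H.inv_mem h
    | mul a b ha hb => rw [map_mul, map_mul]; exact H.mul_mem ha hb
  have h4 : ∀ b, iota M (inr b) ∈ H := fun b => by
    induction b using bd_induction with
    | one => rw [map_one, map_one]; exact H.one_mem
    | mul a b ha hb => rw [map_mul, map_mul]; exact H.mul_mem ha hb
    | inv a ha => rw [map_inv, map_inv]; exact H.inv_mem ha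
    | gen i hi => rw [iota_inr, incl_sg hi]; exact h1 i hi
  have h5 : iota M u ∈ H := by
    rw [← inl_left_mul_inr_right u, map_mul]
    exact H.mul_mem (h3 _) (h4 _)
  obtain ⟨v, hv, hv'⟩ := h5
  exact ⟨v, hv', hv⟩

theorem conj_inl {M : ℕ} (v : Sd M) (f : FreeGroup (Fin (M + 1))) :
    v * inl f * v⁻¹ = inl (v.left * art M v.right f * v.left⁻¹) := by
  conv_lhs => rw [← inl_left_mul_inr_right v]
  rw [mul_assoc (inl _), inr_mul_inl]
  simp only [map_mul, map_inv, mul_inv_rev]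
  group

theorem iota_mem_cent {M : ℕ} {v : Sd M} {k : ℤ} (hk : k ≠ 0)
    (h : v * inl (xl M M ^ k) * v⁻¹ = inl (xl M M ^ k)) : iota M v ∈ cent (M + 1) M := by
  have h1 := h
  rw [conj_inl] at h1
  have h1 := inl_injective h1
  obtain ⟨g, hg⟩ := art_xl_eq_conj v.right M le_rfl
  rw [map_zpow, hg, conj_zpow] at h1
  have h2 : perm M v.right M = M := by
    refine eq_of_conj_xl_zpow (perm_le _ le_rfl) le_rfl hk (h := v.left * g) (m' := k) ?_
    rw [← h1]
    group
  obtain ⟨u, hu, hu'⟩ := exists_lift_mem_cent v.right h2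
  have h3 : v * u⁻¹ = inl (v * u⁻¹).left := by
    refine SemidirectProduct.ext (by simp) ?_
    rw [mul_right, inv_right, hu, mul_inv_cancel, right_inl]
  set f := (v * u⁻¹).left
  have h4 : Commute u (inl (xl M M)) := by
    apply iota_injective
    rw [map_mul, map_mul, iota_last]
    exact commute_sq_of_mem_cent hu'
  have h5 : Commute (v * u⁻¹) (inl (xl M M ^ k)) := by
    rw [map_zpow]
    refine Commute.mul_left ?_ (h4.zpow_right k).inv_left
    rw [← map_zpow]
    exact mul_inv_eq_iff_eq_mul.1 h
  rw [h3] at h5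
  have h6 : Commute f (xl M M ^ k) := by
    apply inl_injective (φ := art M)
    rw [map_mul, map_mul]
    exact h5
  rw [xl_of_lt (by omega)] at h6
  obtain ⟨e, he⟩ := FreeGroup.exists_eq_zpow_of_commute hk h6
  rw [← xl_of_lt] at he
  have h7 : v = inl (xl M M) ^ e * u := by
    rw [← map_zpow, ← he, ← h3, inv_mul_cancel_right]
  rw [h7, map_mul, map_zpow, iota_last]
  exact Subgroup.mul_mem _ (Subgroup.zpow_mem _
    (Subgroup.mul_mem _ (sg_mem_cent _ _) (sg_mem_cent _ _)) _) hu'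

theorem mem_cent_last {M : ℕ} {b : Bd (M + 1)} {k : ℤ} (hk : k ≠ 0)
    (h : Commute b (sq (M + 1) M ^ k)) : b ∈ cent (M + 1) M := by
  obtain ⟨u, k', hk', rfl⟩ := exists_eq_iota_mul_tl b
  have key : ∀ u : Sd M, Commute (iota M u) (sq (M + 1) M ^ k) → iota M u ∈ cent (M + 1) M := by
    intro u hu
    refine iota_mem_cent hk ?_
    rw [mul_inv_eq_iff_eq_mul]
    apply iota_injective
    rw [map_mul, map_mul, map_zpow, map_zpow, iota_last]
    exact hu
  rcases Nat.lt_or_ge k' M with h1 | h1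
  · exfalso
    obtain ⟨M, rfl⟩ : ∃ M', M = M' + 1 := ⟨M - 1, by omega⟩
    have h2 : tl (M + 1) k' * sq (M + 1 + 1) (M + 1) * (tl (M + 1) k')⁻¹ =
        iota (M + 1) (inr (sq (M + 1) M)) := by
      have h3 := tl_shift (M := M + 1) (k := k') (i := M) (by omega) le_rfl
      rw [mul_inv_eq_iff_eq_mul, iota_inr, sq, sq, map_mul, incl_sg (by omega), ← mul_assoc, h3,
        mul_assoc, h3, mul_assoc]
    have h4 : iota (M + 1) (u * inr (sq (M + 1) M) ^ k * u⁻¹) =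
        iota (M + 1) (inl (xl (M + 1) (M + 1)) ^ k) := by
      rw [map_mul, map_mul, map_zpow, map_zpow, ← h2, iota_last, map_inv, conj_zpow]
      refine Eq.trans ?_ (mul_inv_eq_iff_eq_mul.2 h.eq)
      group
    have h5 := congrArg rightHom (iota_injective _ h4)
    rw [map_mul, map_mul, map_zpow, map_zpow, map_inv, rightHom_inl, rightHom_inr, one_zpow,
      mul_inv_eq_one, mul_eq_left] at h5
    exact sq_zpow_ne_one (by omega) hk h5
  rcases Nat.lt_or_ge M k' with h2 | h2
  · obtain rfl : k' = M + 1 := by omega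
    rw [tl_top, mul_one] at h ⊢
    exact key u h
  · obtain rfl : k' = M := by omega
    rw [tl_succ le_rfl, tl_top, one_mul] at h ⊢
    refine Subgroup.mul_mem _ (key u ?_) (sg_mem_cent _ _)
    have h3 : Commute (sg (k' + 1) k')⁻¹ (sq (k' + 1) k' ^ k) :=
      ((commute_sq_of_mem_cent (sg_mem_cent _ _)).zpow_right k).inv_left
    have := h.mul_left h3
    rwa [mul_inv_cancel_right] at this

theorem tl_shift_sq {M k : ℕ} (hk : k ≤ M) :
    tl (M + 1) k * sq (M + 2) (M + 1) = sq (M + 2) M * tl (M + 1) k := by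
  have h := tl_shift (M := M + 1) (k := k) (i := M) hk le_rfl
  rw [sq, sq, ← mul_assoc, h, mul_assoc, h, mul_assoc]

theorem mem_cent_second {M : ℕ} {b : Bd (M + 2)} {k : ℤ} (hk : k ≠ 0)
    (h : Commute b (sq (M + 2) M ^ k)) : b ∈ cent (M + 2) M := by
  have h1 := tl_shift (M := M + 1) (k := M) (i := M) le_rfl le_rfl
  have h2 := tl_shift_sq (M := M) le_rfl
  have h3 := tl_ts_shift (M := M) le_rfl
  generalize tl (M + 1) M = t at *
  have h4 : t⁻¹ * b * t ∈ cent (M + 2) (M + 1) := by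
    refine mem_cent_last hk ?_
    have h5 : sq (M + 2) M = t * sq (M + 2) (M + 1) * t⁻¹ := by rw [h2, mul_inv_cancel_right]
    rw [h5, conj_zpow] at h
    have h6 := h.eq
    rw [← mul_left_cancel_iff (a := t⁻¹), ← mul_right_cancel_iff (a := t)] at h6
    rw [commute_iff_eq]
    convert h6 using 1
    · group
    · group
  obtain ⟨h5, h6⟩ := h4
  have h7 : b = t * (t⁻¹ * b * t) * t⁻¹ := by group
  rw [h7]
  generalize t⁻¹ * b * t = c at *
  have h8 : t⁻¹ * sg (M + 2) M = sg (M + 2) (M + 1) * t⁻¹ := by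
    rw [inv_mul_eq_iff_eq_mul, ← mul_assoc, h1, mul_inv_cancel_right]
  have h9 : jj (M + 2) t⁻¹ * ts (M + 2) M = ts (M + 2) (M + 1) * jj (M + 2) t⁻¹ := by
    calc _ = jj (M + 2) t⁻¹ * (ts (M + 2) M * jj (M + 2) t) * jj (M + 2) t⁻¹ := by
          rw [mul_assoc, mul_assoc, jj_mul_inv, mul_one]
      _ = _ := by rw [← h3, ← mul_assoc, jj_inv_mul, one_mul]
  constructor
  · rw [commute_iff_eq, mul_assoc, h8, ← mul_assoc, mul_assoc t, h5.eq, ← mul_assoc, h1]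
    simp only [mul_assoc]
  · rw [map_mul, map_mul, commute_iff_eq, mul_assoc, h9, ← mul_assoc, mul_assoc (jj _ t), h6.eq,
      ← mul_assoc, h3]
    simp only [mul_assoc]

/-- Conjugation by a braid on the singular braid monoid. -/
def cj {N : ℕ} (b : Bd N) (s : SBMonoid (N + 1)) : SBMonoid (N + 1) := jj N b * s * jj N b⁻¹

theorem cj_mul {N : ℕ} (a b : Bd N) (s : SBMonoid (N + 1)) : cj (a * b) s = cj a (cj b s) := by
  simp only [cj, mul_inv_rev, map_mul, mul_assoc]

theorem cj_apply_mul {N : ℕ} (b : Bd N) (s s' : SBMonoid (N + 1)) :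
    cj b (s * s') = cj b s * cj b s' := by
  rw [cj, cj, cj]
  calc _ = jj N b * s * (jj N b⁻¹ * jj N b) * s' * jj N b⁻¹ := by
        rw [jj_inv_mul, mul_one]
        simp only [mul_assoc]
    _ = _ := by simp only [mul_assoc]

theorem cj_eq {N : ℕ} {b : Bd N} {s s' : SBMonoid (N + 1)} (h : jj N b * s = s' * jj N b) :
    cj b s = s' := by
  rw [cj, h, mul_assoc, jj_mul_inv, mul_one]

theorem cj_jj {N : ℕ} (b c : Bd N) : cj b (jj N c) = jj N (b * c * b⁻¹) := by
  rw [cj, map_mul, map_mul]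

theorem commute_cj {N : ℕ} (b : Bd N) {s s' : SBMonoid (N + 1)} (h : Commute s s') :
    Commute (cj b s) (cj b s') := by
  rw [commute_iff_eq, ← cj_apply_mul, h.eq, cj_apply_mul]

theorem cj_ts_of_mem_cent {N i : ℕ} {b : Bd N} (h : b ∈ cent N i) : cj b (ts N i) = ts N i :=
  cj_eq h.2

/-- Two elements separated by a length function. -/
def Sep {G : Type*} [Group G] (x y : G) : Prop :=
  ∃ ℓ : G → ℕ, ∀ g, (∀ m : ℤ, m ≠ 0 → ℓ g < ℓ (x ^ m * g)) ∨ (∀ m : ℤ, m ≠ 0 → ℓ g < ℓ (y ^ m * g))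

theorem Sep.conj {G : Type*} [Group G] {x y : G} (h : Sep x y) (c : G) :
    Sep (c * x * c⁻¹) (c * y * c⁻¹) := by
  obtain ⟨ℓ, hℓ⟩ := h
  refine ⟨fun g => ℓ (c⁻¹ * g), fun g => ?_⟩
  have h1 : ∀ (x : G) (m : ℤ), c⁻¹ * ((c * x * c⁻¹) ^ m * g) = x ^ m * (c⁻¹ * g) := by
    intro x m
    rw [conj_zpow]
    group
  simpa only [h1] using hℓ (c⁻¹ * g)

theorem commute_conj_iff {G : Type*} [Group G] {x y : G} (c : G) :
    Commute (c * x * c⁻¹) (c * y * c⁻¹) ↔ Commute x y := by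
  have h : ∀ u v : G, c * u * c⁻¹ * (c * v * c⁻¹) = c * (u * v) * c⁻¹ := by intros; group
  rw [commute_iff_eq, commute_iff_eq, h, h, mul_left_inj, mul_right_inj]

/-- The dichotomy between commuting and independent conjugates of the last generator. -/
def Good (M : ℕ) (b : Bd (M + 1)) : Prop :=
  (Commute (b * sq (M + 1) M * b⁻¹) (sq (M + 1) M) →
      Commute (cj b (ts (M + 1) M)) (ts (M + 1) M)) ∧
    (¬Commute (b * sq (M + 1) M * b⁻¹) (sq (M + 1) M) →
      Sep (b * sq (M + 1) M * b⁻¹) (sq (M + 1) M))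

theorem Good.mul_right {M : ℕ} {b v : Bd (M + 1)} (h : Good M b) (hv : v ∈ cent (M + 1) M) :
    Good M (b * v) := by
  have h1 : b * v * sq (M + 1) M * (b * v)⁻¹ = b * sq (M + 1) M * b⁻¹ := by
    rw [mul_assoc b v, (commute_sq_of_mem_cent hv).eq]
    group
  have h2 : cj (b * v) (ts (M + 1) M) = cj b (ts (M + 1) M) := by
    rw [cj_mul, cj_ts_of_mem_cent hv]
  rw [Good, h1, h2]
  exact h

theorem Good.mul_left {M : ℕ} {b v : Bd (M + 1)} (h : Good M b) (hv : v ∈ cent (M + 1) M) :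
    Good M (v * b) := by
  have h1 : v * b * sq (M + 1) M * (v * b)⁻¹ = v * (b * sq (M + 1) M * b⁻¹) * v⁻¹ := by group
  have h2 : sq (M + 1) M = v * sq (M + 1) M * v⁻¹ := by
    rw [(commute_sq_of_mem_cent hv).eq, mul_inv_cancel_right]
  have h3 : Commute (v * b * sq (M + 1) M * (v * b)⁻¹) (sq (M + 1) M) ↔
      Commute (b * sq (M + 1) M * b⁻¹) (sq (M + 1) M) := by
    rw [h1]
    conv_lhs => arg 2; rw [h2]
    exact commute_conj_iff v
  constructor
  · intro h4
    have h5 := commute_cj v (h.1 (h3.1 h4))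
    rwa [cj_ts_of_mem_cent hv, ← cj_mul] at h5
  · intro h4
    have h5 := (h.2 (mt h3.2 h4)).conj v
    rwa [← h1, ← h2] at h5

/-- The fibre component of the coset of the last strand. -/
def rf {M : ℕ} (g : Bd (M + 1)) : FreeGroup (Fin (M + 1)) := (act g (1, M + 1)).1.left

theorem rf_iota_mul {M : ℕ} (v : Sd M) (g : Bd (M + 1)) :
    rf (iota M v * g) = v.left * art M v.right (rf g) := by
  have h := act_left g v (1, M + 1)
  rw [mul_one] at h
  rw [rf, act_mul, act_iota, one_mul, h, mul_left]
  rfl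

theorem rf_iota_inl_mul {M : ℕ} (f : FreeGroup (Fin (M + 1))) (g : Bd (M + 1)) :
    rf (iota M (inl f) * g) = f * rf g := by
  rw [rf_iota_mul, left_inl, right_inl, map_one, MulAut.one_apply]

theorem rf_iota_inr_mul {M : ℕ} (b : Bd M) (g : Bd (M + 1)) :
    rf (iota M (inr b) * g) = art M b (rf g) := by
  rw [rf_iota_mul, left_inr, right_inr, one_mul]

theorem commute_iota_iff {M : ℕ} {u v : Sd M} :
    Commute (iota M u) (iota M v) ↔ Commute u v := by
  rw [commute_iff_eq, commute_iff_eq, ← map_mul, ← map_mul, (iota_injective M).eq_iff]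

theorem commute_inl_iff {M : ℕ} {f g : FreeGroup (Fin (M + 1))} :
    Commute (inl f : Sd M) (inl g) ↔ Commute f g := by
  rw [commute_iff_eq, commute_iff_eq, ← map_mul, ← map_mul, inl_injective.eq_iff]

/-- The conjugate of a letter of the fibre by an element of the semidirect product. -/
theorem exists_conj_inl_last {M : ℕ} (u : Sd M) :
    ∃ h, u * inl (xl M M) * u⁻¹ = inl (h * xl M (perm M u.right M) * h⁻¹) := by
  obtain ⟨h, hh⟩ := art_xl_eq_conj u.right M le_rfl
  refine ⟨u.left * h, ?_⟩
  rw [conj_inl, hh]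
  congr 1
  group

theorem good_iota {M : ℕ} (u : Sd M) : Good M (iota M u) := by
  obtain ⟨h, hh⟩ := exists_conj_inl_last u
  have hp := perm_le u.right (le_refl M)
  set p := perm M u.right M
  have hx : iota M u * sq (M + 1) M * (iota M u)⁻¹ = iota M (inl (h * xl M p * h⁻¹)) := by
    rw [← hh, map_mul, map_mul, map_inv, iota_last]
  rw [Good, hx]
  constructor
  · intro hc
    rw [← iota_last, commute_iota_iff, commute_inl_iff, ← zpow_one (xl M M),
      xl_of_lt (by omega : M < M + 1)] at hc
    obtain ⟨e, he⟩ := FreeGroup.exists_eq_zpow_of_commute one_ne_zero hc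
    rw [← xl_of_lt] at he
    have hpM : p = M := eq_of_conj_xl_zpow hp le_rfl one_ne_zero (m' := e) (by rw [zpow_one, he])
    have he1 : e = 1 := by
      have := congrArg (expo M M) he
      rw [expo_conj, hpM, map_zpow, expo_xl _ le_rfl, if_pos rfl, ← ofAdd_zsmul,
        Multiplicative.ofAdd.injective.eq_iff] at this
      simp at this
      exact this.symm
    rw [he, he1, zpow_one, iota_last] at hx
    have : iota M u ∈ cent (M + 1) M :=
      mem_cent_last one_ne_zero (by rw [zpow_one]; exact mul_inv_eq_iff_eq_mul.1 hx)
    rw [cj_ts_of_mem_cent this]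
  · intro hc
    rw [← iota_last, commute_iota_iff, commute_inl_iff] at hc
    have hc' : ¬Commute (FreeGroup.of (⟨M, by omega⟩ : Fin (M + 1)))
        (h * FreeGroup.of (⟨p, by omega⟩ : Fin (M + 1)) * h⁻¹) := by
      rw [← xl_of_lt, ← xl_of_lt]
      exact fun H => hc H.symm
    obtain ⟨ℓ, hℓ⟩ := FreeGroup.exists_length_conj_conj hc'
    rw [← xl_of_lt, ← xl_of_lt] at hℓ
    refine ⟨fun g => ℓ (rf g), fun g => ?_⟩
    simp only [← iota_last, ← map_zpow, rf_iota_inl_mul]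
    exact (hℓ (rf g)).symm

end Braid

namespace FreeGroup

variable {G : Type*} [Group G]

/-- The action of a group on the free group over itself by left translation of the letters. -/
def translate (G : Type*) [Group G] : G →* MulAut (FreeGroup G) where
  toFun g := freeGroupCongr (Equiv.mulLeft g)
  map_one' := by
    refine MulEquiv.ext fun f => ?_
    change map (fun x => 1 * x) f = f
    simp only [one_mul]
    exact map.id f
  map_mul' a b := by
    refine MulEquiv.ext fun f => ?_
    change map (fun x => a * b * x) f = map (fun x => a * x) (map (fun x => b * x) f)
    rw [map.comp]
    simp only [mul_assoc]
    rfl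

theorem translate_apply (g : G) (f : FreeGroup G) : translate G g f = map (fun x => g * x) f := rfl

/-- Functoriality of the semidirect product of the translation action. -/
def translateMap (θ : MulAut G) :
    FreeGroup G ⋊[translate G] G →* FreeGroup G ⋊[translate G] G :=
  SemidirectProduct.map (map θ) θ.toMonoidHom fun g => by
    ext x
    simp [translate_apply]

theorem translateMap_left (θ : MulAut G) (v : FreeGroup G ⋊[translate G] G) :
    (translateMap θ v).left = map θ v.left := rfl

theorem translateMap_right (θ : MulAut G) (v : FreeGroup G ⋊[translate G] G) :
    (translateMap θ v).right = θ v.right := rfl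

end FreeGroup

namespace Braid

open SemidirectProduct

open FreeGroup (translate translateMap translateMap_left translateMap_right)

/-- The splitting of the letter `p` off the fibre. -/
def split (M p : ℕ) : FreeGroup (Fin (M + 1)) →*
    FreeGroup (FreeGroup (Fin (M + 1))) ⋊[translate _] FreeGroup (Fin (M + 1)) :=
  FreeGroup.lift fun q => if (q : ℕ) = p then inl (FreeGroup.of 1) else inr (FreeGroup.of q)

theorem split_xl_self {M p : ℕ} (hp : p ≤ M) : split M p (xl M p) = inl (FreeGroup.of 1) := by
  rw [xl_of_lt (by omega), split, FreeGroup.lift_apply_of, if_pos rfl]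

theorem split_xl_ne {M p q : ℕ} (hq : q ≤ M) (h : q ≠ p) : split M p (xl M q) = inr (xl M q) := by
  rw [xl_of_lt (by omega), split, FreeGroup.lift_apply_of, if_neg h]

/-- The inverse of the splitting on its image. -/
def unsplit (M p : ℕ) :
    FreeGroup (FreeGroup (Fin (M + 1))) ⋊[translate _] FreeGroup (Fin (M + 1)) →*
      FreeGroup (Fin (M + 1)) :=
  SemidirectProduct.lift (FreeGroup.lift fun f => f * xl M p * f⁻¹) (MonoidHom.id _) fun g => by
    ext x
    simp [FreeGroup.translate_apply, mul_assoc]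

theorem unsplit_split {M p : ℕ} (hp : p ≤ M) (f : FreeGroup (Fin (M + 1))) :
    unsplit M p (split M p f) = f := by
  have : (unsplit M p).comp (split M p) = MonoidHom.id _ := hom_ext_xl fun q hq => by
    rw [MonoidHom.comp_apply, MonoidHom.id_apply]
    by_cases h : q = p
    · subst h
      rw [split_xl_self hq, unsplit, SemidirectProduct.lift_inl, FreeGroup.lift_apply_of]
      simp
    · rw [split_xl_ne hq h, unsplit, SemidirectProduct.lift_inr, MonoidHom.id_apply]
  exact DFunLike.congr_fun this f

theorem split_injective {M p : ℕ} (hp : p ≤ M) : Function.Injective (split M p) :=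
  Function.LeftInverse.injective (unsplit_split hp)

theorem art_sq_last {M q : ℕ} (h : q < M) : art (M + 1) (sq (M + 1) M) (xl (M + 1) q) =
    xl (M + 1) q := by
  rw [sq, map_mul, MulAut.mul_apply, art_sg_xl (by omega), if_neg (by omega), if_neg (by omega),
    art_sg_xl (by omega), if_neg (by omega), if_neg (by omega)]

theorem split_art_sg {M p : ℕ} (hp : p < M) (f : FreeGroup (Fin (M + 2))) :
    split (M + 1) p (art (M + 1) (sg (M + 1) M) f) =
      translateMap (art (M + 1) (sg (M + 1) M)) (split (M + 1) p f) := by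
  have : (split (M + 1) p).comp (art (M + 1) (sg (M + 1) M)).toMonoidHom =
      (translateMap (art (M + 1) (sg (M + 1) M))).comp (split (M + 1) p) := by
    refine hom_ext_xl fun q hq => ?_
    have hM := art_sg_xl (M := M + 1) (k := M) (by omega)
    simp only [MonoidHom.comp_apply, MulEquiv.coe_toMonoidHom]
    by_cases h1 : q = p
    · subst h1
      rw [split_xl_self hq, hM, if_neg (by omega), if_neg (by omega), split_xl_self hq]
      refine SemidirectProduct.ext ?_ ?_
      · rw [translateMap_left, left_inl, FreeGroup.map.of, map_one]
      · rw [translateMap_right, right_inl, map_one]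
    · have h3 : translateMap (art (M + 1) (sg (M + 1) M)) (split (M + 1) p (xl (M + 1) q)) =
          inr (art (M + 1) (sg (M + 1) M) (xl (M + 1) q)) := by
        rw [split_xl_ne hq h1]
        refine SemidirectProduct.ext ?_ ?_
        · rw [translateMap_left, left_inr, left_inr, map_one]
        · rw [translateMap_right, right_inr, right_inr]
      rw [h3, hM]
      split_ifs
      · rw [split_xl_ne le_rfl (by omega)]
      · rw [map_mul, map_mul, map_inv, split_xl_ne le_rfl (by omega),
          split_xl_ne (by omega) (by omega), map_mul, map_mul, map_inv]
      · rw [split_xl_ne hq h1]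
  exact DFunLike.congr_fun this f

theorem translateMap_mul {G : Type*} [Group G] (θ η : MulAut G)
    (v : FreeGroup G ⋊[translate G] G) :
    translateMap (θ * η) v = translateMap θ (translateMap η v) := by
  refine SemidirectProduct.ext ?_ rfl
  rw [translateMap_left, translateMap_left, translateMap_left, FreeGroup.map.comp]
  rfl

theorem translateMap_one {G : Type*} [Group G] (v : FreeGroup G ⋊[translate G] G) :
    translateMap 1 v = v :=
  SemidirectProduct.ext (FreeGroup.map.id _) rfl

theorem split_art_sq_zpow {M p : ℕ} (hp : p < M) (m : ℤ) (f : FreeGroup (Fin (M + 2))) :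
    split (M + 1) p (art (M + 1) (sq (M + 1) M ^ m) f) =
      translateMap (art (M + 1) (sq (M + 1) M ^ m)) (split (M + 1) p f) := by
  let H : Subgroup (Bd (M + 1)) :=
    { carrier := {β | ∀ f, split (M + 1) p (art (M + 1) β f) =
        translateMap (art (M + 1) β) (split (M + 1) p f)}
      one_mem' := fun f => by rw [map_one, translateMap_one, MulAut.one_apply]
      mul_mem' := fun {a b} ha hb f => by
        rw [map_mul, translateMap_mul, MulAut.mul_apply, ha, hb]
      inv_mem' := fun {a} ha f => by
        have h := ha (art (M + 1) a⁻¹ f)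
        rw [← MulAut.mul_apply, ← map_mul, mul_inv_cancel, map_one, MulAut.one_apply] at h
        rw [h, ← translateMap_mul, ← map_mul, inv_mul_cancel, map_one, translateMap_one] }
  have h : sg (M + 1) M ∈ H := fun f => split_art_sg hp f
  exact H.zpow_mem (H.mul_mem h h) m f

theorem expo_art {M : ℕ} {β : Bd M} (h : perm M β = 1) (q : ℕ) (f : FreeGroup (Fin (M + 1))) :
    expo M q (art M β f) = expo M q f := by
  have : (expo M q).comp (art M β).toMonoidHom = expo M q := hom_ext_xl fun j hj => by
    obtain ⟨g, hg⟩ := art_xl_eq_conj β j hj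
    change expo M q (art M β (xl M j)) = _
    rw [hg, h, Equiv.Perm.one_apply, expo_conj]
  exact DFunLike.congr_fun this f

theorem perm_sq {N i : ℕ} (hi : i < N) : perm N (sq N i) = 1 := by
  rw [sq, map_mul, perm_sg hi, Equiv.swap_mul_self]

theorem perm_iota {M : ℕ} (u : Sd M) : perm (M + 1) (iota M u) = perm M u.right := by
  have h : (perm (M + 1)).comp (iota M) = (perm M).comp rightHom := by
    refine SemidirectProduct.hom_ext (hom_ext_xl fun i hi => ?_) (MonoidHom.ext fun b => ?_)
    · simp only [MonoidHom.comp_apply]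
      rw [iota_xl hi, rightHom_inl, map_one, pg, map_mul, map_mul, map_inv, ← sq,
        perm_sq (by omega), mul_one, mul_inv_cancel]
    · simp only [MonoidHom.comp_apply]
      rw [iota_inr, rightHom_inr]
      induction b using bd_induction with
      | one => simp only [map_one]
      | mul a b ha hb => simp only [map_mul, ha, hb]
      | inv a ha => simp only [map_inv, ha]
      | gen i hi => rw [incl_sg hi, perm_sg hi, perm_sg (by omega)]
  exact DFunLike.congr_fun h u

theorem perm_tl {M k j : ℕ} (hk : k ≤ M) (hkj : k ≤ j) (hj : j ≤ M) :
    perm (M + 1) (tl M k) (j + 1) = j := by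
  have hlt : ∀ k ≤ M + 1, ∀ j < k, perm (M + 1) (tl M k) j = j := by
    refine down_induction ?_ ?_
    · intro j _
      rw [tl_top, map_one, Equiv.Perm.one_apply]
    · intro k hk ih j hj
      rw [tl_succ (by omega), map_mul, perm_sg (by omega), Equiv.Perm.mul_apply, swap_lt hj,
        ih j (by omega)]
  revert hkj
  refine down_induction (p := fun k => k ≤ j → perm (M + 1) (tl M k) (j + 1) = j) ?_ ?_ k hk
  · intro h
    obtain rfl : j = M := by omega
    rw [tl_succ le_rfl, tl_top, one_mul, perm_sg (by omega), swap_self_right]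
  · intro k hk ih h
    rw [tl_succ (by omega), map_mul, perm_sg (by omega), Equiv.Perm.mul_apply]
    rcases h.eq_or_lt with rfl | h
    · rw [swap_self_right, hlt _ (by omega) _ (by omega)]
    · rw [swap_gt (by omega), ih h]

theorem iota_inr_sq (N : ℕ) : iota (N + 1) (inr (sq (N + 1) N)) = sq (N + 2) N := by
  rw [iota_inr, sq, map_mul, incl_sg (by omega), sq]

theorem split_conj_xl {M p : ℕ} (hp : p ≤ M) (h : FreeGroup (Fin (M + 1))) :
    split M p (h * xl M p * h⁻¹) = inl ((split M p h).left *
      FreeGroup.of (split M p h).right * (split M p h).left⁻¹) := by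
  rw [map_mul, map_mul, map_inv, split_xl_self hp]
  generalize split M p h = V
  refine SemidirectProduct.ext ?_ ?_
  · have h1 : translate _ V.right (FreeGroup.of 1) = FreeGroup.of V.right := by
      rw [FreeGroup.translate_apply, FreeGroup.map.of, mul_one]
    simp [h1]
  · simp

theorem sep_inr_sq_inl {N p : ℕ} (hp : p < N) (h : FreeGroup (Fin (N + 2)))
    (hne : ∀ m : ℤ, m ≠ 0 → art (N + 1) (sq (N + 1) N ^ m) (h * xl (N + 1) p * h⁻¹) ≠
      h * xl (N + 1) p * h⁻¹) :
    Sep (iota (N + 1) (inr (sq (N + 1) N))) (iota (N + 1) (inl (h * xl (N + 1) p * h⁻¹))) := by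
  have hw := split_conj_xl (by omega : p ≤ N + 1) h
  set w := h * xl (N + 1) p * h⁻¹
  set v := (split (N + 1) p h).left
  set s := (split (N + 1) p h).right
  have hπ : ∀ m : ℤ, ⇑(MulAut.toPerm _ (art (N + 1) (sq (N + 1) N)) ^ m) =
      ⇑(art (N + 1) (sq (N + 1) N ^ m)) := fun m => by
    rw [← map_zpow, ← map_zpow]
    rfl
  classical
  obtain ⟨ℓ, hℓ⟩ := FreeGroup.exists_length_map_conj (s := s) (v := v)
    (MulAut.toPerm _ (art (N + 1) (sq (N + 1) N))) fun m hm e => hne m hm <| by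
      refine split_injective (by omega : p ≤ N + 1) ?_
      rw [split_art_sq_zpow hp, hw]
      refine SemidirectProduct.ext ?_ ?_
      · rw [translateMap_left, left_inl, ← hπ]
        exact e
      · rw [translateMap_right, right_inl, map_one]
  refine ⟨fun g => ℓ (split (N + 1) p (rf g)).left, fun g => ?_⟩
  simp only [← map_zpow, rf_iota_inr_mul, rf_iota_inl_mul, split_art_sq_zpow hp]
  have h1 : ∀ m : ℤ, (split (N + 1) p (w ^ m * rf g)).left =
      (v * FreeGroup.of s * v⁻¹) ^ m * (split (N + 1) p (rf g)).left := fun m => by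
    rw [map_mul, map_zpow, hw, ← map_zpow, mul_left, left_inl, right_inl, map_one,
      MulAut.one_apply]
  simp only [h1, translateMap_left, ← hπ]
  exact hℓ _

theorem art_sq_eq_self {N p : ℕ} (hp : p < N) {h : FreeGroup (Fin (N + 2))}
    (hw : art (N + 1) (sq (N + 1) N) (h * xl (N + 1) p * h⁻¹) = h * xl (N + 1) p * h⁻¹) :
    art (N + 1) (sq (N + 1) N) h = h := by
  have h1 : Commute (h⁻¹ * art (N + 1) (sq (N + 1) N) h) (xl (N + 1) p ^ (1 : ℤ)) := by
    rw [map_mul, map_mul, map_inv, art_sq_last hp] at hw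
    rw [mul_inv_eq_iff_eq_mul] at hw
    rw [zpow_one, commute_iff_eq, mul_assoc, hw]
    group
  rw [xl_of_lt (by omega)] at h1
  obtain ⟨e, he⟩ := FreeGroup.exists_eq_zpow_of_commute one_ne_zero h1
  rw [← xl_of_lt] at he
  have he0 := congrArg (expo (N + 1) p) he
  rw [map_mul, map_inv, expo_art (perm_sq (by omega)), inv_mul_cancel, map_zpow,
    expo_xl _ (by omega), if_pos rfl, ← ofAdd_zsmul, ← ofAdd_zero,
    Multiplicative.ofAdd.injective.eq_iff, smul_eq_mul, mul_one] at he0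
  rw [← he0, zpow_zero, inv_mul_eq_one] at he
  exact he.symm

theorem exists_transport_last {M p : ℕ} (hp : p ≤ M) : ∃ d : Bd (M + 1),
    d * sq (M + 1) M = sq (M + 1) p * d ∧
      jj (M + 1) d * ts (M + 1) M = ts (M + 1) p * jj (M + 1) d := by
  refine down_induction (p := fun p => ∃ d : Bd (M + 1), d * sq (M + 1) M = sq (M + 1) p * d ∧
      jj (M + 1) d * ts (M + 1) M = ts (M + 1) p * jj (M + 1) d) ?_ ?_ p hp
  · exact ⟨1, by rw [one_mul, mul_one], by rw [map_one, one_mul, mul_one]⟩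
  · rintro k hk ⟨d, hd, hd'⟩
    have h1 := sg_ts_braid (N := M + 1) (i := k + 1) (j := k) (by omega) (by omega) (.inr rfl)
    have h2 := braid_sq (sg_braid (N := M + 1) (i := k) (by omega)).symm
    refine ⟨sg (M + 1) (k + 1) * sg (M + 1) k * d, ?_, ?_⟩
    · rw [mul_assoc, hd, ← mul_assoc, sq, h2, mul_assoc, sq]
    · rw [map_mul, mul_assoc, hd', ← mul_assoc, h1, mul_assoc]

theorem good_of_perm_lt {N k : ℕ} (u : Sd (N + 1)) (hk : k ≤ N)
    (hp : perm (N + 1) u⁻¹.right (N + 1) < N) :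
    Good (N + 1) (iota (N + 1) u * tl (N + 1) k) := by
  obtain ⟨h, hh⟩ := exists_conj_inl_last u⁻¹
  set p := perm (N + 1) u⁻¹.right (N + 1)
  set w := h * xl (N + 1) p * h⁻¹ with hw
  set U := iota (N + 1) u with hU
  set η := sq (N + 1) N with hη
  have hx : U * tl (N + 1) k * sq (N + 2) (N + 1) * (U * tl (N + 1) k)⁻¹ =
      U * iota (N + 1) (inr η) * U⁻¹ := by
    rw [mul_assoc U, tl_shift_sq hk, iota_inr_sq]
    group
  have hy : sq (N + 2) (N + 1) = U * iota (N + 1) (inl w) * U⁻¹ := by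
    rw [← hh, hU, ← map_inv, ← map_mul, ← map_mul, ← iota_last]
    congr 1
    group
  have hfix : ∀ β : Bd (N + 1), Commute (iota (N + 1) (inr β)) (iota (N + 1) (inl w)) ↔
      art (N + 1) β w = w := fun β => by
    rw [commute_iota_iff, commute_iff_eq, inr_mul_inl, mul_left_inj, inl_injective.eq_iff]
  constructor
  · intro hc
    rw [hx, show sq (N + 1 + 1) (N + 1) = _ from hy, commute_conj_iff, hfix] at hc
    have h1 := art_sq_eq_self hp hc
    set H := iota (N + 1) (inl h) with hH
    have h2 : H ∈ cent (N + 2) N := by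
      refine mem_cent_second one_ne_zero ?_
      rw [zpow_one, ← iota_inr_sq, hH, commute_iota_iff, commute_iff_eq, inr_mul_inl, ← hη, h1]
    obtain ⟨d, hd, hd'⟩ := exists_transport_last (by omega : p ≤ N + 1)
    set t := tl (N + 1) (p + 1) with ht
    have h3 : sq (N + 2) (N + 1) =
        U * H * (t * d) * sq (N + 2) (N + 1) * (U * H * (t * d))⁻¹ := by
      have h4 : iota (N + 1) (inl (xl (N + 1) p)) = t * sq (N + 2) p * t⁻¹ := by
        rw [iota_xl (by omega), pg, sq]
      have h5 : sq (N + 2) p = d * sq (N + 2) (N + 1) * d⁻¹ := by rw [hd, mul_inv_cancel_right]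
      conv_lhs => rw [hy, hw, map_mul, map_mul, map_mul, map_mul, map_inv, map_inv, ← hH, h4, h5]
      group
    have h4 : U * H * (t * d) ∈ cent (N + 2) (N + 1) := by
      refine mem_cent_last one_ne_zero ?_
      rw [zpow_one]
      exact (mul_inv_eq_iff_eq_mul.1 h3.symm)
    have h5 := cj_ts_of_mem_cent h4
    rw [cj_mul, cj_mul, cj_mul, cj_eq hd'] at h5
    have h6 : cj (U * tl (N + 1) k) (ts (N + 2) (N + 1)) =
        cj U (cj H (cj t (ts (N + 2) (N + 1)))) := by
      rw [cj_mul, cj_eq (tl_ts_shift hk), ht, cj_eq (tl_ts_shift (by omega)),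
        cj_ts_of_mem_cent h2]
    rw [h6]
    nth_rw 2 [← h5]
    exact commute_cj _ (commute_cj _ (commute_cj _ (ts_ts_comm (by omega)).symm))
  · intro hc
    rw [hx, show sq (N + 1 + 1) (N + 1) = _ from hy]
    refine Sep.conj (sep_inr_sq_inl hp h fun m hm e => hc ?_) U
    rw [← hw, ← hη, ← hfix, map_zpow, map_zpow, ← commute_conj_iff U, ← conj_zpow, ← hx, ← hy,
      conj_zpow] at e
    set b := U * tl (N + 1) k
    set y := sq (N + 2) (N + 1)
    have h1 : Commute (b⁻¹ * y * b) (y ^ m) := by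
      rw [← commute_conj_iff b]
      have : b * (b⁻¹ * y * b) * b⁻¹ = y := by group
      rw [this]
      exact e.symm
    have h2 := commute_sq_of_mem_cent (mem_cent_last hm h1)
    rw [← commute_conj_iff b] at h2
    have h3 : b * (b⁻¹ * y * b) * b⁻¹ = y := by group
    rw [h3] at h2
    exact h2.symm

theorem good_of_iota_mul_tl {N k : ℕ} (u : Sd (N + 1)) (hk : k ≤ N) :
    Good (N + 1) (iota (N + 1) u * tl (N + 1) k) := by
  have hb : ∀ j, k ≤ j → j ≤ N + 1 →
      perm (N + 2) (iota (N + 1) u * tl (N + 1) k) (j + 1) = perm (N + 1) u.right j := by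
    intro j h1 h2
    rw [map_mul, Equiv.Perm.mul_apply, perm_tl (by omega) h1 h2, perm_iota]
  have hs := sg_mem_cent (N + 2) (N + 1)
  have hps : perm (N + 2) (sg (N + 2) (N + 1)) = Equiv.swap (N + 1) (N + 1 + 1) :=
    perm_sg (by omega)
  have hinv : perm (N + 1) u.right (perm (N + 1) u⁻¹.right (N + 1)) = N + 1 := by
    rw [← Equiv.Perm.mul_apply, ← map_mul, SemidirectProduct.inv_right, mul_inv_cancel, map_one,
      Equiv.Perm.one_apply]
  have hp := perm_le u⁻¹.right (le_refl (N + 1))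
  rcases Nat.lt_or_ge (perm (N + 1) u⁻¹.right (N + 1)) N with h | h
  · exact good_of_perm_lt u hk h
  set b := iota (N + 1) u * tl (N + 1) k
  rcases h.eq_or_lt with h | h
  · rw [← h] at hinv
    obtain ⟨v, hv⟩ := eq_iota_of_perm (b := sg (N + 2) (N + 1) * (b * sg (N + 2) (N + 1))) (by
      rw [map_mul, map_mul]
      simp only [Equiv.Perm.mul_apply]
      rw [hps, swap_self_right, hb _ hk (by omega), hinv, swap_self_left])
    have h1 := ((good_iota v).mul_left (inv_mem hs)).mul_right (inv_mem hs)
    rwa [← hv, inv_mul_cancel_left, mul_inv_cancel_right] at h1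
  · rw [show perm (N + 1) u⁻¹.right (N + 1) = N + 1 by omega] at hinv
    obtain ⟨v, hv⟩ := eq_iota_of_perm (b := sg (N + 2) (N + 1) * b) (by
      rw [map_mul]
      simp only [Equiv.Perm.mul_apply]
      rw [hps, hb _ (by omega) le_rfl, hinv, swap_self_left])
    have h1 := (good_iota v).mul_left (inv_mem hs)
    rwa [← hv, inv_mul_cancel_left] at h1

theorem good {M : ℕ} (b : Bd (M + 1)) : Good M b := by
  obtain ⟨u, k, hk, rfl⟩ := exists_eq_iota_mul_tl b
  rcases Nat.lt_or_ge k M with h | h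
  · obtain ⟨N, rfl⟩ : ∃ N, M = N + 1 := ⟨M - 1, by omega⟩
    exact good_of_iota_mul_tl u (by omega)
  rcases h.eq_or_lt with rfl | h
  · rw [tl_succ le_rfl, tl_top, one_mul]
    exact (good_iota u).mul_right (sg_mem_cent _ _)
  · obtain rfl : k = M + 1 := by omega
    rw [tl_top, mul_one]
    exact good_iota u

theorem commute_conj_symm {G : Type*} [Group G] {g s : G} (h : Commute (g * s * g⁻¹) s) :
    Commute (g⁻¹ * s * g⁻¹⁻¹) s := by
  rw [← commute_conj_iff g]
  have h1 : g * (g⁻¹ * s * g⁻¹⁻¹) * g⁻¹ = s := by group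
  rw [h1]
  exact h.symm

theorem conj_sg_mem_cent {M : ℕ} {g : Bd (M + 1)}
    (h : Commute (g * sq (M + 1) M * g⁻¹) (sq (M + 1) M)) :
    g * sg (M + 1) M * g⁻¹ ∈ cent (M + 1) M := by
  have h1 : g⁻¹ * sq (M + 1) M * g⁻¹⁻¹ ∈ cent (M + 1) M :=
    mem_cent_last one_ne_zero (by rw [zpow_one]; exact commute_conj_symm h)
  refine mem_cent_last one_ne_zero ?_
  have h2 := (commute_conj_iff g).2 h1.1.symm
  rw [zpow_one]
  convert h2 using 1
  group

theorem commute_cj_delta {M : ℕ} {g : Bd (M + 1)}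
    (h : Commute (g * sq (M + 1) M * g⁻¹) (sq (M + 1) M)) :
    Commute (cj g (ts (M + 1) M * jj (M + 1) (sg (M + 1) M)))
      (ts (M + 1) M * jj (M + 1) (sg (M + 1) M)) := by
  have h1 := conj_sg_mem_cent h
  have h2 := commute_cj g (conj_sg_mem_cent (commute_conj_symm h)).2
  rw [cj_jj, show g * (g⁻¹ * sg (M + 1) M * g⁻¹⁻¹) * g⁻¹ = sg (M + 1) M by group] at h2
  rw [cj_apply_mul, cj_jj]
  exact (((good g).1 h).mul_right h2.symm).mul_left (h1.2.mul_right (h1.1.map (jj (M + 1))))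

theorem conj_eq_conj_conj {G : Type*} [Group G] (b c s : G) :
    b * s * b⁻¹ = c * (c⁻¹ * b * s * (c⁻¹ * b)⁻¹) * c⁻¹ := by group

theorem mem_cent_of_conj_eq {M : ℕ} {b c : Bd (M + 1)} {k : ℤ} (hk : k ≠ 0)
    (h : (b * sq (M + 1) M * b⁻¹) ^ k = (c * sq (M + 1) M * c⁻¹) ^ k) :
    c⁻¹ * b ∈ cent (M + 1) M := by
  refine mem_cent_last hk ?_
  rw [conj_zpow, conj_zpow, mul_inv_eq_iff_eq_mul] at h
  rw [commute_iff_eq, mul_assoc, h]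
  group

theorem cj_delta_eq {M : ℕ} {b c : Bd (M + 1)} (h : c⁻¹ * b ∈ cent (M + 1) M) :
    cj b (ts (M + 1) M * jj (M + 1) (sg (M + 1) M)) =
      cj c (ts (M + 1) M * jj (M + 1) (sg (M + 1) M)) := by
  rw [← mul_inv_cancel_left c b, cj_mul]
  congr 1
  rw [cj_apply_mul, cj_ts_of_mem_cent h, cj_jj, h.1.eq, mul_inv_cancel_right]

theorem desing_injective_of_two_le (M : ℕ) : Function.Injective (desing (M + 2)) := by
  refine MonoidAlgebra.injective_of_conjugates (jj (M + 1))
    (fun _ : Unit => ts (M + 1) M * jj (M + 1) (sg (M + 1) M)) (fun _ => sq (M + 1) M)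
    (desing (M + 2)) (closure_jj_ts M) desing_jj (fun _ => desing_ts (by omega)) (deg (M + 1))
    (fun _ => ?_) ?_ ?_ ?_ ?_
  · rw [sq, map_mul, deg_sg (by omega)]
    rfl
  · intro b _ c _ m hm h
    rw [← zpow_natCast, ← zpow_natCast] at h
    have h1 := commute_sq_of_mem_cent (mem_cent_of_conj_eq (by exact_mod_cast hm) h)
    rw [conj_eq_conj_conj b c, h1.eq, mul_inv_cancel_right]
  · intro b _ c _ h
    exact cj_delta_eq (mem_cent_of_conj_eq one_ne_zero (by rw [h]))
  · intro b _ c _ h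
    rw [conj_eq_conj_conj b c, commute_conj_iff] at h
    have h1 := commute_cj c (commute_cj_delta h)
    rwa [← cj_mul, mul_inv_cancel_left] at h1
  · intro b _ c _ h A C e
    rw [conj_eq_conj_conj b c, commute_conj_iff] at h
    obtain ⟨ℓ, hℓ⟩ := ((good (c⁻¹ * b)).2 h).conj c
    rw [← conj_eq_conj_conj] at hℓ
    have hne : ∀ (g : Bd (M + 1)) (m : ℤ), m ≠ 0 → (g * sq (M + 1) M * g⁻¹) ^ m ≠ 1 := by
      intro g m hm e
      rw [conj_zpow, mul_inv_eq_one, mul_eq_left] at e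
      exact sq_zpow_ne_one (by omega) hm e
    exact MonoidAlgebra.eq_zero_of_sub_one_mul_eq (hne b) (hne c) ℓ hℓ e

theorem desing_injective (n : ℕ) : Function.Injective (desing n) := by
  rcases Nat.lt_or_ge n 2 with h | h
  · have hempty : IsEmpty (SGen n) := ⟨fun g => by
      rcases g with i | i | i <;> exact absurd i.2 (by omega)⟩
    have h1 := closure_sGen n
    rw [Set.range_eq_empty, Submonoid.closure_empty] at h1
    have : ∀ s : SBMonoid n, s = 1 := fun s => by
      rw [← Submonoid.mem_bot, h1]
      exact Submonoid.mem_top s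
    exact fun s t _ => (this s).trans (this t).symm
  · obtain ⟨M, rfl⟩ : ∃ M, n = M + 2 := ⟨n - 2, by omega⟩
    exact desing_injective_of_two_le M

end Braid

/-- (Paris) The desingularization map is injective: there is a well-defined monoid
homomorphism `ψ` from the singular braid monoid `SBₙ` to the multiplicative monoid of the
integral group ring `ℤBₙ` with `ψ(σᵢ) = σᵢ`, `ψ(σ̄ᵢ) = σᵢ⁻¹`, `ψ(τᵢ) = σᵢ - σᵢ⁻¹`,
and `ψ` is injective. -/
theorem desingularization_injective (n : ℕ) :
    ∃ ψ : SBMonoid n →* MonoidAlgebra ℤ (BraidGroup n),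
      (∀ i : Fin (n - 1), ψ (sGen n (.pos i)) =
        MonoidAlgebra.of ℤ (BraidGroup n) (PresentedGroup.of i)) ∧
      (∀ i : Fin (n - 1), ψ (sGen n (.neg i)) =
        MonoidAlgebra.of ℤ (BraidGroup n) (PresentedGroup.of i)⁻¹) ∧
      (∀ i : Fin (n - 1), ψ (sGen n (.sing i)) =
        MonoidAlgebra.of ℤ (BraidGroup n) (PresentedGroup.of i) -
          MonoidAlgebra.of ℤ (BraidGroup n) (PresentedGroup.of i)⁻¹) ∧
      Function.Injective ψ :=
  ⟨Braid.desing n, fun i => Braid.desing_sGen (.pos i), fun i => Braid.desing_sGen (.neg i),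
    fun i => Braid.desing_sGen (.sing i), Braid.desing_injective n⟩
end

section
/- (Fenn–Keyman–Rourke) The singular braid monoid embeds in the singular braid group: the monoid homomorphism SB_n → GB_n determined by σ_i ↦ σ_i, σ̄_i ↦ σ_i⁻¹ and τ_i ↦ τ_i is well defined and injective. -/
/-- Generators of the singular braid group `GBₙ`: the elementary braids `σᵢ`
and the elementary singular braids `τᵢ`. -/
inductive GGen (n : ℕ) : Type
  | s : Fin (n - 1) → GGen n
  | t : Fin (n - 1) → GGen n

/-- The letter `g` viewed as a generator of the free group. -/
def gw {n : ℕ} (g : GGen n) : FreeGroup (GGen n) := FreeGroup.of g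

/-- Relators of the singular braid group `GBₙ`: `σᵢ τᵢ = τᵢ σᵢ`; for `|i - j| ≥ 2`,
`σᵢ σⱼ = σⱼ σᵢ`, `σᵢ τⱼ = τⱼ σᵢ` and `τᵢ τⱼ = τⱼ τᵢ`; and for `|i - j| = 1`,
`σᵢ σⱼ σᵢ = σⱼ σᵢ σⱼ` and `σᵢ σⱼ τᵢ = τⱼ σᵢ σⱼ`. -/
def gbRels (n : ℕ) : Set (FreeGroup (GGen n)) :=
  {w | (∃ i : Fin (n - 1),
          w = gw (.s i) * gw (.t i) * (gw (.t i) * gw (.s i))⁻¹) ∨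
       (∃ i j : Fin (n - 1), ((i : ℕ) + 2 ≤ (j : ℕ) ∨ (j : ℕ) + 2 ≤ (i : ℕ)) ∧
          (w = gw (.s i) * gw (.s j) * (gw (.s j) * gw (.s i))⁻¹ ∨
           w = gw (.s i) * gw (.t j) * (gw (.t j) * gw (.s i))⁻¹ ∨
           w = gw (.t i) * gw (.t j) * (gw (.t j) * gw (.t i))⁻¹)) ∨
       (∃ i j : Fin (n - 1), ((i : ℕ) + 1 = (j : ℕ) ∨ (j : ℕ) + 1 = (i : ℕ)) ∧
          (w = gw (.s i) * gw (.s j) * gw (.s i) *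
                 (gw (.s j) * gw (.s i) * gw (.s j))⁻¹ ∨
           w = gw (.s i) * gw (.s j) * gw (.t i) *
                 (gw (.t j) * gw (.s i) * gw (.s j))⁻¹))}

/-- The singular braid group `GBₙ`. -/
abbrev GBGroup (n : ℕ) : Type := PresentedGroup (gbRels n)

/-- The conjugation action of the units of a monoid on its elements. -/
def unitsConj (M : Type*) [Monoid M] : Mˣ →* Equiv.Perm M :=
  (MulAction.toPermHom (ConjAct Mˣ) M).comp ConjAct.toConjAct.toMonoidHom

section

variable {M : Type*} [Monoid M]

lemma unitsConj_apply (u : Mˣ) (x : M) : unitsConj M u x = u * x * ↑u⁻¹ := rfl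

lemma unitsConj_apply_mul_val (u : Mˣ) (x : M) : unitsConj M u x * u = u * x := by
  simp [unitsConj_apply]

lemma unitsConj_apply_eq_of_mul_eq {u : Mˣ} {x y : M} (h : ↑u * x = y * ↑u) :
    unitsConj M u x = y := by
  rw [unitsConj_apply, h, Units.mul_inv_cancel_right]

lemma unitsConj_list_prod (u : Mˣ) (l : List M) :
    (l.map (unitsConj M u)).prod = unitsConj M u l.prod := by
  induction l with
  | nil => simp [unitsConj_apply]
  | cons x l ih => simp [ih, unitsConj_apply, mul_assoc]

lemma commute_unitsConj_iff (u : Mˣ) (x y : M) :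
    Commute (unitsConj M u x) (unitsConj M u y) ↔ Commute x y := by
  simp only [Commute, SemiconjBy, unitsConj_apply, mul_assoc, Units.inv_mul_cancel_left,
    Units.mul_right_inj]
  simp only [← mul_assoc, Units.mul_left_inj]

/-- Two elements are dependent when they are equal or fail to commute. -/
def Dependent (a b : M) : Prop := a = b ∨ ¬ Commute a b

lemma dependent_unitsConj_iff (u : Mˣ) (x y : M) :
    Dependent (unitsConj M u x) (unitsConj M u y) ↔ Dependent x y := by
  simp [Dependent, commute_unitsConj_iff]

end

open Classical in
/-- Two words have the same product as soon as their restrictions to every pair of dependent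
letters coincide. -/
theorem List.prod_eq_of_filter_dependent_eq {M : Type*} [Monoid M] :
    ∀ l l' : List M,
      (∀ a b : M, Dependent a b →
        l.filter (fun x ↦ x = a ∨ x = b) = l'.filter (fun x ↦ x = a ∨ x = b)) →
      l.prod = l'.prod
  | [], l', h => by
    rcases l' with _ | ⟨y, l'⟩
    · rfl
    · simpa using h y y (.inl rfl)
  | x :: t, l', h => by
    have hx : x ∈ l' := by
      have : x ∈ l'.filter (fun z ↦ z = x ∨ z = x) := by
        rw [← h x x (.inl rfl)]; simp
      exact (List.mem_filter.1 this).1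
    obtain ⟨p, q, rfl, hxp⟩ := List.eq_append_cons_of_mem hx
    have indep : ∀ y ∈ p, ¬ Dependent x y := by
      intro y hy hd
      have key := h x y hd
      rw [List.filter_append, List.filter_cons_of_pos (by simp)] at key
      have hne : p.filter (fun z ↦ z = x ∨ z = y) ≠ [] := by
        intro h0
        simpa using List.filter_eq_nil_iff.1 h0 y hy
      obtain ⟨z, s, hs⟩ := List.exists_cons_of_ne_nil hne
      rw [hs, List.cons_append, List.cons.injEq] at key
      have hz : z ∈ p.filter (fun z ↦ z = x ∨ z = y) := by rw [hs]; simp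
      exact hxp (key.1 ▸ (List.mem_filter.1 hz).1)
    have hcomm : Commute x p.prod := Commute.list_prod_right _ _ fun y hy ↦ by
      by_contra hc
      exact indep y hy (.inr hc)
    have hrec : t.prod = (p ++ q).prod := by
      refine List.prod_eq_of_filter_dependent_eq t (p ++ q) fun a b hab ↦ ?_
      have key := h a b hab
      by_cases hxab : x = a ∨ x = b
      · have hp : p.filter (fun z ↦ z = a ∨ z = b) = [] := by
          refine List.filter_eq_nil_iff.2 fun y hy hyab ↦ ?_
          have hn := indep y hy
          simp only [decide_eq_true_eq] at hyab
          have hba : Dependent b a := hab.imp Eq.symm fun hc hc' ↦ hc hc'.symm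
          rcases hxab with rfl | rfl <;> rcases hyab with rfl | rfl
          · exact hn (.inl rfl)
          · exact hn hab
          · exact hn hba
          · exact hn (.inl rfl)
        rw [List.filter_append, hp, List.filter_cons_of_pos (by simpa using hxab),
          List.filter_cons_of_pos (by simpa using hxab)] at key
        rw [List.filter_append, hp]
        simpa using key
      · rw [List.filter_append, List.filter_cons_of_neg (by simpa using hxab),
          List.filter_cons_of_neg (by simpa using hxab)] at key
        rw [List.filter_append, key]
    rw [List.prod_cons, hrec, List.prod_append, List.prod_append, List.prod_cons, ← mul_assoc,
      hcomm.eq, mul_assoc]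

theorem FreeGroup.list_eq_of_prod_map_of_eq {α : Type*} {l l' : List α}
    (h : (l.map FreeGroup.of).prod = (l'.map FreeGroup.of).prod) : l = l' := by
  have hmk : ∀ l : List α,
      (l.map FreeGroup.of).prod = FreeGroup.mk (l.map fun x ↦ (x, true)) := by
    intro l
    induction l with
    | nil => rfl
    | cons x l ih => rw [List.map_cons, List.prod_cons, ih]; rfl
  have hred : ∀ l : List α, FreeGroup.IsReduced (l.map fun x ↦ (x, true)) := by
    intro l
    rw [FreeGroup.IsReduced, List.isChain_map]
    exact (List.pairwise_of_forall fun _ _ _ ↦ rfl).isChain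
  rw [hmk, hmk, FreeGroup.Red.exact] at h
  obtain ⟨c, hc, hc'⟩ := h
  rw [(hred l).red_iff_eq] at hc
  rw [(hred l').red_iff_eq] at hc'
  exact List.map_injective_iff.2 (fun _ _ hxy ↦ congrArg Prod.fst hxy) (hc.symm.trans hc')

section

variable {M : Type*} [Monoid M]

variable (M) in
/-- The action of the units of `M` by conjugation on both the indices and the letters of a family
of elements of the free group on `M` indexed by pairs of elements of `M`. -/
def pairAction : Mˣ →* MulAut (M × M → FreeGroup M) where
  toFun u :=
    { toFun := fun F p ↦ FreeGroup.map (unitsConj M u)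
        (F ((unitsConj M u).symm p.1, (unitsConj M u).symm p.2))
      invFun := fun F p ↦ FreeGroup.map (unitsConj M u).symm
        (F (unitsConj M u p.1, unitsConj M u p.2))
      left_inv := fun F ↦ by
        ext1 p
        simp [FreeGroup.map.comp]
      right_inv := fun F ↦ by
        ext1 p
        simp [FreeGroup.map.comp]
      map_mul' := fun F F' ↦ by ext1 p; simp }
  map_one' := by
    ext F p
    simp [Equiv.Perm.one_def]
  map_mul' u v := by
    ext F p
    simp [FreeGroup.map.comp, Equiv.Perm.mul_def]

open Classical in
/-- The letter `x` seen in every pair of dependent elements containing it. -/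
noncomputable def pairLetter (x : M) : M × M → FreeGroup M := fun p ↦
  if Dependent p.1 p.2 ∧ (x = p.1 ∨ x = p.2) then FreeGroup.of x else 1

lemma pairAction_pairLetter (u : Mˣ) (x : M) :
    pairAction M u (pairLetter x) = pairLetter (unitsConj M u x) := by
  ext1 p
  obtain ⟨a, b⟩ := p
  obtain ⟨a, rfl⟩ := (unitsConj M u).surjective a
  obtain ⟨b, rfl⟩ := (unitsConj M u).surjective b
  have h : (Dependent a b ∧ (x = a ∨ x = b)) ↔
      Dependent (unitsConj M u a) (unitsConj M u b) ∧
        (unitsConj M u x = unitsConj M u a ∨ unitsConj M u x = unitsConj M u b) := by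
    simp [dependent_unitsConj_iff]
  simp only [pairAction, pairLetter, MonoidHom.coe_mk, OneHom.coe_mk, MulEquiv.coe_mk,
    Equiv.coe_fn_mk]
  split_ifs with h₁ h₂ h₂ <;> simp only [Equiv.symm_apply_apply, h] at h₁
  · simp
  · exact absurd h₁ h₂
  · exact absurd h₂ h₁
  · simp

lemma Commute.pairLetter {x y : M} (h : Commute x y) :
    Commute (pairLetter x) (pairLetter y) := by
  refine Pi.commute_iff.2 fun p ↦ ?_
  obtain ⟨a, b⟩ := p
  unfold _root_.pairLetter
  split_ifs with h₁ h₂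
  · suffices x = y by rw [this]
    obtain ⟨hd, h₁⟩ := h₁
    obtain ⟨-, h₂⟩ := h₂
    rcases hd with hd | hd
    · grind
    · rcases h₁ with rfl | rfl <;> rcases h₂ with rfl | rfl
      · rfl
      · exact absurd h hd
      · exact absurd h.symm hd
      · rfl
  · exact Commute.one_right _
  · exact Commute.one_left _
  · exact Commute.one_left _

/-- The product of the letters of a word determines the product of the word. -/
theorem prod_eq_of_pairLetter_prod_eq {l l' : List M}
    (h : (l.map pairLetter).prod = (l'.map pairLetter).prod) : l.prod = l'.prod := by
  classical
  refine List.prod_eq_of_filter_dependent_eq l l' fun a b hab ↦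
    FreeGroup.list_eq_of_prod_map_of_eq ?_
  have hproj : ∀ l : List M, (l.map pairLetter).prod (a, b) =
      ((l.filter fun x ↦ x = a ∨ x = b).map FreeGroup.of).prod := by
    intro l
    induction l with
    | nil => rfl
    | cons x l ih =>
      rw [List.map_cons, List.prod_cons, Pi.mul_apply, ih]
      by_cases hx : x = a ∨ x = b
      · rw [List.filter_cons_of_pos (by simpa using hx)]
        simp [pairLetter, hab, hx]
      · rw [List.filter_cons_of_neg (by simpa using hx)]
        simp [pairLetter, hx]
  rw [← hproj, ← hproj, h]

variable (M) in
/-- A group in which words in elements of `M` followed by a unit of `M` can be compared. -/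
abbrev PairGroup : Type _ := (M × M → FreeGroup M) ⋊[pairAction M] Mˣ

lemma PairGroup.inr_mul_inl_pairLetter (u : Mˣ) (x : M) :
    (SemidirectProduct.inr u * SemidirectProduct.inl (pairLetter x) : PairGroup M) =
      SemidirectProduct.inl (pairLetter (unitsConj M u x)) * SemidirectProduct.inr u := by
  rw [← pairAction_pairLetter, SemidirectProduct.inl_aut]
  simp

lemma PairGroup.inr_mul_inl_pairLetter_of_mul_eq {u : Mˣ} {x y : M} (h : ↑u * x = y * ↑u) :
    (SemidirectProduct.inr u * SemidirectProduct.inl (pairLetter x) : PairGroup M) =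
      SemidirectProduct.inl (pairLetter y) * SemidirectProduct.inr u := by
  rw [inr_mul_inl_pairLetter, unitsConj_apply_eq_of_mul_eq h]

/-- The word `l` followed by the unit `u` in `PairGroup M`. -/
noncomputable def PairGroup.ofWord (l : List M) (u : Mˣ) : PairGroup M :=
  ⟨(l.map pairLetter).prod, u⟩

lemma PairGroup.inr_mul_ofWord (u v : Mˣ) (l : List M) :
    SemidirectProduct.inr u * PairGroup.ofWord l v =
      PairGroup.ofWord (l.map (unitsConj M u)) (u * v) := by
  ext1
  · simp [PairGroup.ofWord, -SemidirectProduct.mk_eq_inl_mul_inr, map_list_prod, Function.comp_def,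
      pairAction_pairLetter]
  · simp [PairGroup.ofWord]

lemma PairGroup.inl_mul_ofWord (x : M) (v : Mˣ) (l : List M) :
    SemidirectProduct.inl (pairLetter x) * PairGroup.ofWord l v =
      PairGroup.ofWord (x :: l) v := by
  ext1 <;> simp [PairGroup.ofWord]

lemma PairGroup.mul_eq_of_ofWord_eq {l l' : List M} {u u' : Mˣ}
    (h : PairGroup.ofWord l u = PairGroup.ofWord l' u') : l.prod * u = l'.prod * u' := by
  have hl := congrArg SemidirectProduct.left h
  have hu : u = u' := congrArg SemidirectProduct.right h
  rw [prod_eq_of_pairLetter_prod_eq hl, hu]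

end

section

variable {n : ℕ}

lemma SBRel.mk'_eq {v w : FreeMonoid (SGen n)} (h : SBRel n v w) :
    (conGen (SBRel n)).mk' v = (conGen (SBRel n)).mk' w :=
  (Con.eq _).2 (.of _ _ h)

/-- The generator `σᵢ` as a unit of the singular braid monoid. -/
def sbUnit (i : Fin (n - 1)) : (SBMonoid n)ˣ where
  val := sGen n (.pos i)
  inv := sGen n (.neg i)
  val_inv := (SBRel.posNeg i).mk'_eq
  inv_val := (SBRel.negPos i).mk'_eq

/-- The images of the generators of the singular braid group in `PairGroup (SBMonoid n)`. -/
noncomputable def gbPairGen : GGen n → PairGroup (SBMonoid n)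
  | .s i => SemidirectProduct.inr (sbUnit i)
  | .t i => SemidirectProduct.inl (pairLetter (sGen n (.sing i)))

lemma lift_gbPairGen_eq_one (r : FreeGroup (GGen n)) (hr : r ∈ gbRels n) :
    FreeGroup.lift gbPairGen r = 1 := by
  rcases hr with ⟨i, rfl⟩ | ⟨i, j, h, rfl | rfl | rfl⟩ | ⟨i, j, h, rfl | rfl⟩ <;>
    rw [map_mul, map_inv, mul_inv_eq_one] <;>
    simp only [map_mul, gw, FreeGroup.lift_apply_of, gbPairGen]
  · exact PairGroup.inr_mul_inl_pairLetter_of_mul_eq (SBRel.posSing i).mk'_eq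
  · rw [← map_mul, ← map_mul]
    exact congrArg _ (Units.ext (SBRel.commPosPos i j h).mk'_eq)
  · exact PairGroup.inr_mul_inl_pairLetter_of_mul_eq (SBRel.commPosSing i j h).mk'_eq
  · have hc : Commute (sGen n (.sing i)) (sGen n (.sing j)) := (SBRel.commSingSing i j h).mk'_eq
    exact (hc.pairLetter.map _).eq
  · simp only [← map_mul]
    exact congrArg _ (Units.ext (SBRel.braidPos i j h).mk'_eq)
  · rw [mul_assoc (SemidirectProduct.inl _), ← map_mul]
    exact PairGroup.inr_mul_inl_pairLetter_of_mul_eq (SBRel.braidSing i j h).mk'_eq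

/-- The homomorphism from the singular braid group to `PairGroup (SBMonoid n)`. -/
noncomputable def gbToPairGroup (n : ℕ) : GBGroup n →* PairGroup (SBMonoid n) :=
  PresentedGroup.toGroup lift_gbPairGen_eq_one

/-- The images of the generators of the singular braid monoid in the singular braid group. -/
def sbToGBGen : SGen n → GBGroup n
  | .pos i => PresentedGroup.of (.s i)
  | .neg i => (PresentedGroup.of (.s i))⁻¹
  | .sing i => PresentedGroup.of (.t i)

lemma lift_sbToGBGen_eq {v w : FreeMonoid (SGen n)} (h : SBRel n v w) :
    FreeMonoid.lift sbToGBGen v = FreeMonoid.lift sbToGBGen w := by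
  cases h <;> simp only [sw, map_mul, map_one, FreeMonoid.lift_eval_of, sbToGBGen]
  case posNeg i => exact mul_inv_cancel _
  case negPos i => exact inv_mul_cancel _
  case posSing i => exact PresentedGroup.mk_eq_mk_of_mul_inv_mem (.inl ⟨i, rfl⟩)
  case commPosPos i j h =>
    exact PresentedGroup.mk_eq_mk_of_mul_inv_mem (.inr (.inl ⟨i, j, h, .inl rfl⟩))
  case commPosSing i j h =>
    exact PresentedGroup.mk_eq_mk_of_mul_inv_mem (.inr (.inl ⟨i, j, h, .inr (.inl rfl)⟩))
  case commSingSing i j h =>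
    exact PresentedGroup.mk_eq_mk_of_mul_inv_mem (.inr (.inl ⟨i, j, h, .inr (.inr rfl)⟩))
  case braidPos i j h =>
    exact PresentedGroup.mk_eq_mk_of_mul_inv_mem (.inr (.inr ⟨i, j, h, .inl rfl⟩))
  case braidSing i j h =>
    exact PresentedGroup.mk_eq_mk_of_mul_inv_mem (.inr (.inr ⟨i, j, h, .inr rfl⟩))

/-- The canonical homomorphism from the singular braid monoid to the singular braid group. -/
def sbToGB (n : ℕ) : SBMonoid n →* GBGroup n :=
  (conGen (SBRel n)).lift (FreeMonoid.lift sbToGBGen)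
    (Con.conGen_le.2 fun _ _ h ↦ lift_sbToGBGen_eq h)

lemma sbToGB_sGen (g : SGen n) : sbToGB n (sGen n g) = sbToGBGen g := by
  simp [sbToGB, sGen, sw]

/-- Every singular braid is a product of elements of the monoid followed by a unit, compatibly
with the homomorphism to `PairGroup (SBMonoid n)`. -/
lemma exists_ofWord_eq (m : SBMonoid n) :
    ∃ (l : List (SBMonoid n)) (u : (SBMonoid n)ˣ),
      m = l.prod * u ∧ gbToPairGroup n (sbToGB n m) = PairGroup.ofWord l u := by
  have hs : ∀ i, gbToPairGroup n (PresentedGroup.of (.s i)) =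
      SemidirectProduct.inr (sbUnit i) := fun i ↦ PresentedGroup.toGroup.of lift_gbPairGen_eq_one
  have ht : ∀ i, gbToPairGroup n (PresentedGroup.of (.t i)) =
      SemidirectProduct.inl (pairLetter (sGen n (.sing i))) :=
    fun i ↦ PresentedGroup.toGroup.of lift_gbPairGen_eq_one
  obtain ⟨w, rfl⟩ := Con.mk'_surjective m
  induction w using FreeMonoid.inductionOn' with
  | one => exact ⟨[], 1, by simp, by rw [map_one, map_one, map_one]; rfl⟩
  | of_mul g w ih =>
    obtain ⟨l, u, hm, hl⟩ := ih
    have hg : (conGen (SBRel n)).mk' (FreeMonoid.of g) = sGen n g := rfl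
    rw [map_mul, map_mul, map_mul, hl, hm, hg, sbToGB_sGen]
    have key : ∀ v : (SBMonoid n)ˣ,
        ↑v * (l.prod * ↑u) = (l.map (unitsConj _ v)).prod * ↑(v * u) := fun v ↦ by
      rw [unitsConj_list_prod, Units.val_mul, ← mul_assoc, ← mul_assoc, unitsConj_apply_mul_val]
    cases g with
    | pos i =>
      exact ⟨_, _, key (sbUnit i), by
        rw [sbToGBGen, hs, PairGroup.inr_mul_ofWord]⟩
    | neg i =>
      exact ⟨_, _, key (sbUnit i)⁻¹, by
        rw [sbToGBGen, map_inv, hs, ← map_inv, PairGroup.inr_mul_ofWord]⟩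
    | sing i =>
      exact ⟨sGen n (.sing i) :: l, u, by rw [List.prod_cons, mul_assoc], by
        rw [sbToGBGen, ht, PairGroup.inl_mul_ofWord]⟩

theorem sbToGB_injective (n : ℕ) : Function.Injective (sbToGB n) := by
  intro a b hab
  obtain ⟨l, u, ha, hl⟩ := exists_ofWord_eq a
  obtain ⟨l', u', hb, hl'⟩ := exists_ofWord_eq b
  rw [ha, hb]
  exact PairGroup.mul_eq_of_ofWord_eq (by rw [← hl, ← hl', hab])

end

/-- (Fenn–Keyman–Rourke) The singular braid monoid embeds in the singular braid group:
the monoid homomorphism `SBₙ → GBₙ` with `σᵢ ↦ σᵢ`, `σ̄ᵢ ↦ σᵢ⁻¹`, `τᵢ ↦ τᵢ`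
is well defined and injective. -/
theorem singular_braid_monoid_embeds_in_group (n : ℕ) :
    ∃ f : SBMonoid n →* GBGroup n,
      (∀ i : Fin (n - 1), f (sGen n (.pos i)) = PresentedGroup.of (GGen.s i)) ∧
      (∀ i : Fin (n - 1), f (sGen n (.neg i)) = (PresentedGroup.of (GGen.s i))⁻¹) ∧
      (∀ i : Fin (n - 1), f (sGen n (.sing i)) = PresentedGroup.of (GGen.t i)) ∧
      Function.Injective f := by
  exact ⟨sbToGB n, fun i ↦ sbToGB_sGen _, fun i ↦ sbToGB_sGen _, fun i ↦ sbToGB_sGen _,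
    sbToGB_injective n⟩
end
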